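/- arXiv:2503.16882 — 6 statements merged into one kernel-verified Lean document; each statement's English description precedes it below -/
import Mathlib

section
/- Let A be a Hermitian matrix written in block form A = [A_{ij}]_{i,j=1}^k, where the diagonal blocks A_{ii} are square (so A_{ii} is the principal submatrix of A on the i-th block of indices). For every real number p ≥ 1, the positive p-energy is super-additive over the diagonal blocks: E_p^+(A) ≥ Σ_{i=1}^k E_p^+(A_{ii}). -/
open Matrix Finset

/-- The positive `p`-energy of a Hermitian matrix: the sum of the `p`-th powers of its
positive eigenvalues (counted with multiplicity). -/
noncomputable def posEnergy {m : Type*} [Fintype m] [DecidableEq m] {A : Matrix m m ℂ}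
    (hA : A.IsHermitian) (p : ℝ) : ℝ :=
  ∑ i, if 0 < hA.eigenvalues i then hA.eigenvalues i ^ p else 0

open Unitary in
/-- **Peierls' inequality**: a convex function summed over the diagonal entries of a Hermitian
matrix in an orthonormal basis is at most its sum over the eigenvalues. -/
theorem sum_convex_diag_le_sum_convex_eigenvalues {n : Type*} [Fintype n] [DecidableEq n]
    {A : Matrix n n ℂ} (hA : A.IsHermitian) {V : Matrix n n ℂ} (hV : V ∈ unitaryGroup n ℂ)
    {f : ℝ → ℝ} (hf : ConvexOn ℝ Set.univ f) :
    ∑ a, f ((star V * A * V) a a).re ≤ ∑ j, f (hA.eigenvalues j) := by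
  set W : Matrix n n ℂ := star (hA.eigenvectorUnitary : Matrix n n ℂ) * V with hW
  have hWmem : W ∈ unitaryGroup n ℂ :=
    mul_mem (star_mem hA.eigenvectorUnitary.2) hV
  have hcol (a : n) : ∑ j, Complex.normSq (W j a) = 1 := by
    have h := congrFun₂ (mem_unitaryGroup_iff'.1 hWmem) a a
    simp only [Matrix.mul_apply, star_apply, one_apply_eq, RCLike.star_def,
      ← Complex.normSq_eq_conj_mul_self] at h
    exact_mod_cast h
  have hrow (j : n) : ∑ a, Complex.normSq (W j a) = 1 := by
    have h := congrFun₂ (mem_unitaryGroup_iff.1 hWmem) j j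
    simp only [Matrix.mul_apply, star_apply, one_apply_eq, RCLike.star_def,
      Complex.mul_conj] at h
    exact_mod_cast h
  have hdiag (a : n) : ((star V * A * V) a a).re =
      ∑ j, Complex.normSq (W j a) * hA.eigenvalues j := by
    have h : star V * A * V =
        star W * diagonal (RCLike.ofReal ∘ hA.eigenvalues : n → ℂ) * W := by
      conv_lhs => rw [hA.spectral_theorem, conjStarAlgAut_apply]
      simp only [hW, star_mul, star_star, Matrix.mul_assoc]
    have h' : (star V * A * V) a a =
        ((∑ j, Complex.normSq (W j a) * hA.eigenvalues j : ℝ) : ℂ) := by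
      rw [h, Matrix.mul_apply]
      push_cast
      refine sum_congr rfl fun j _ ↦ ?_
      rw [mul_diagonal, star_apply, Complex.normSq_eq_conj_mul_self]
      simp only [Function.comp_apply, RCLike.star_def, Complex.coe_algebraMap, RCLike.ofReal]
      ring
    rw [h', Complex.ofReal_re]
  calc ∑ a, f ((star V * A * V) a a).re
      ≤ ∑ a, ∑ j, Complex.normSq (W j a) * f (hA.eigenvalues j) := by
        refine sum_le_sum fun a _ ↦ ?_
        rw [hdiag]
        exact hf.map_sum_le (fun j _ ↦ Complex.normSq_nonneg _) (hcol a) fun j _ ↦ Set.mem_univ _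
    _ = ∑ j, f (hA.eigenvalues j) := by
        rw [sum_comm]
        simp_rw [← sum_mul, hrow, one_mul]

theorem convexOn_max_zero_rpow {p : ℝ} (hp : 1 ≤ p) :
    ConvexOn ℝ Set.univ fun x : ℝ ↦ max x 0 ^ p := by
  refine ⟨convex_univ, fun x _ y _ a b ha hb hab ↦ ?_⟩
  refine le_trans ?_ ((convexOn_rpow hp).2 (le_max_right x 0) (le_max_right y 0) ha hb hab)
  simp only [smul_eq_mul]
  refine Real.rpow_le_rpow (le_max_right _ _) (max_le ?_ (by positivity)) (by linarith)
  gcongr <;> exact le_max_left _ _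

theorem posEnergy_eq_sum_max_rpow {m : Type*} [Fintype m] [DecidableEq m] {A : Matrix m m ℂ}
    (hA : A.IsHermitian) {p : ℝ} (hp : p ≠ 0) :
    posEnergy hA p = ∑ i, max (hA.eigenvalues i) 0 ^ p := by
  refine sum_congr rfl fun i _ ↦ ?_
  split_ifs with h
  · rw [max_eq_left h.le]
  · rw [max_eq_right (not_lt.1 h), Real.zero_rpow hp]

theorem blockDiagonal'_mem_unitaryGroup {ι : Type*} [Fintype ι] [DecidableEq ι] {m : ι → Type*}
    [∀ i, Fintype (m i)] [∀ i, DecidableEq (m i)] {U : ∀ i, Matrix (m i) (m i) ℂ}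
    (hU : ∀ i, U i ∈ unitaryGroup (m i) ℂ) :
    blockDiagonal' U ∈ unitaryGroup (Σ i, m i) ℂ := by
  rw [mem_unitaryGroup_iff, star_eq_conjTranspose, blockDiagonal'_conjTranspose,
    ← blockDiagonal'_mul, ← blockDiagonal'_one]
  exact congrArg _ (funext fun i ↦ mem_unitaryGroup_iff.1 (hU i))

theorem star_blockDiagonal'_mul_mul_apply {ι : Type*} [Fintype ι] [DecidableEq ι] {m : ι → Type*}
    [∀ i, Fintype (m i)] (U : ∀ i, Matrix (m i) (m i) ℂ)
    (A : Matrix (Σ i, m i) (Σ i, m i) ℂ) (i : ι) (a b : m i) :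
    (star (blockDiagonal' U) * A * blockDiagonal' U) ⟨i, a⟩ ⟨i, b⟩ =
      (star (U i) * A.submatrix (Sigma.mk i) (Sigma.mk i) * U i) a b := by
  simp only [Matrix.mul_apply, Fintype.sum_sigma, star_apply]
  rw [sum_eq_single_of_mem i (mem_univ i) fun j _ hj ↦ by
    simp [blockDiagonal'_apply_ne _ _ _ hj]]
  refine sum_congr rfl fun c _ ↦ ?_
  rw [sum_eq_single_of_mem i (mem_univ i) fun j _ hj ↦ by
    simp [blockDiagonal'_apply_ne _ _ _ hj]]
  simp [blockDiagonal'_apply_eq]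

/-- Super-additivity of the positive `p`-energy over the diagonal blocks of a Hermitian
block matrix. -/
theorem posEnergy_superadditive {k : ℕ} {m : Fin k → Type*}
    [∀ i, Fintype (m i)] [∀ i, DecidableEq (m i)]
    (A : Matrix (Σ i, m i) (Σ i, m i) ℂ) (hA : A.IsHermitian) (p : ℝ) (hp : 1 ≤ p) :
    ∑ i, posEnergy (hA.submatrix (Sigma.mk i)) p ≤ posEnergy hA p := by
  have hp0 : p ≠ 0 := by linarith
  simp_rw [posEnergy_eq_sum_max_rpow _ hp0]
  have hB (i : Fin k) := hA.submatrix (Sigma.mk i : m i → Σ i, m i)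
  have h := sum_convex_diag_le_sum_convex_eigenvalues hA
    (blockDiagonal'_mem_unitaryGroup fun i ↦ (hB i).eigenvectorUnitary.2)
    (convexOn_max_zero_rpow hp)
  refine le_of_eq_of_le ?_ h
  rw [Fintype.sum_sigma]
  refine sum_congr rfl fun i _ ↦ sum_congr rfl fun a _ ↦ ?_
  have hdiag := (hB i).conjStarAlgAut_star_eigenvectorUnitary
  rw [Unitary.conjStarAlgAut_star_apply] at hdiag
  rw [star_blockDiagonal'_mul_mul_apply, hdiag]
  simp
end

section
/- Let p ≥ 4 be a real number and let G be a connected graph of order n ≥ 3 that is not isomorphic to the complete graph K_n. Then E_p^-(G) ≥ n. -/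
open Matrix Finset
open scoped Classical

lemma adjMatrix_isHermitian {V : Type*} [Fintype V] [DecidableEq V] (G : SimpleGraph V) :
    (G.adjMatrix ℝ).IsHermitian :=
  Matrix.IsHermitian.ext fun i j => by simp [SimpleGraph.adj_comm]

/-- The positive `p`-energy of a graph: the sum of the `p`-th powers of the positive
eigenvalues of its adjacency matrix (counted with multiplicity). -/
noncomputable def gPosEnergy {V : Type*} [Fintype V] [DecidableEq V]
    (G : SimpleGraph V) (p : ℝ) : ℝ :=
  ∑ i, if 0 < (adjMatrix_isHermitian G).eigenvalues i then
    (adjMatrix_isHermitian G).eigenvalues i ^ p else 0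

/-- The negative `p`-energy of a graph: the sum of the `p`-th powers of the absolute values
of the negative eigenvalues of its adjacency matrix (counted with multiplicity). -/
noncomputable def gNegEnergy {V : Type*} [Fintype V] [DecidableEq V]
    (G : SimpleGraph V) (p : ℝ) : ℝ :=
  ∑ i, if (adjMatrix_isHermitian G).eigenvalues i < 0 then
    |(adjMatrix_isHermitian G).eigenvalues i| ^ p else 0
namespace SimpleGraph

variable {V : Type*} [Fintype V] [DecidableEq V] (G : SimpleGraph V)

/-- `c` is certified as a lower bound for the negative energy of `G` restricted to `S`: there are
pairwise orthogonal nonzero vectors supported on `S` with Rayleigh quotients at most `-τ i ≤ -1`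
such that `c ≤ ∑ i, τ i ^ 4`. -/
def HasRayleighBound (S : Finset V) (c : ℝ) : Prop :=
  ∃ (ι : Type) (_ : Fintype ι) (u : ι → V → ℝ) (τ : ι → ℝ),
    (∀ i, ∀ v ∉ S, u i v = 0) ∧ (∀ i, u i ≠ 0) ∧ (∀ i j, i ≠ j → u i ⬝ᵥ u j = 0) ∧
    (∀ i, 1 ≤ τ i ∧ u i ⬝ᵥ (G.adjMatrix ℝ *ᵥ u i) ≤ -τ i * (u i ⬝ᵥ u i)) ∧
    c ≤ ∑ i, τ i ^ 4

variable {G}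

/-- Jensen's inequality for the negative part of the spectrum of a Hermitian matrix. -/
lemma rpow_le_sum_of_rayleigh_le {A : Matrix V V ℝ} (hA : A.IsHermitian)
    {p : ℝ} (hp : 1 ≤ p) {t : ℝ} (ht : 0 ≤ t) (x : EuclideanSpace ℝ V) (hx : ‖x‖ = 1)
    (hq : x.ofLp ⬝ᵥ (A *ᵥ x.ofLp) ≤ -t) :
    t ^ p ≤ ∑ j, (inner ℝ (hA.eigenvectorBasis j) x) ^ 2 * max (-hA.eigenvalues j) 0 ^ p := by
  have hsum : ∑ j, (inner ℝ (hA.eigenvectorBasis j) x) ^ 2 = 1 := by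
    have h := hA.eigenvectorBasis.sum_sq_norm_inner_right x
    simpa [hx] using h
  have hray : x.ofLp ⬝ᵥ (A *ᵥ x.ofLp) =
      ∑ j, (inner ℝ (hA.eigenvectorBasis j) x) ^ 2 * hA.eigenvalues j := by
    have h1 : x.ofLp ⬝ᵥ (A *ᵥ x.ofLp) = inner ℝ x (WithLp.toLp 2 (A *ᵥ x.ofLp)) := by
      simp [EuclideanSpace.inner_eq_star_dotProduct, dotProduct_comm]
    rw [h1, ← hA.eigenvectorBasis.sum_inner_mul_inner]
    refine Finset.sum_congr rfl fun j _ => ?_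
    have h2 : inner ℝ (hA.eigenvectorBasis j) (WithLp.toLp 2 (A *ᵥ x.ofLp)) =
        hA.eigenvalues j * inner ℝ (hA.eigenvectorBasis j) x := by
      have h3 := hA.mulVec_eigenvectorBasis j
      have hAt : Aᵀ = A := by rw [← conjTranspose_eq_transpose_of_trivial]; exact hA
      simp only [EuclideanSpace.inner_eq_star_dotProduct, star_trivial]
      rw [dotProduct_comm, dotProduct_mulVec, ← mulVec_transpose, hAt, h3, smul_dotProduct,
        smul_eq_mul, dotProduct_comm]
    rw [h2, real_inner_comm]
    ring
  have h1 : t ≤ ∑ j, (inner ℝ (hA.eigenvectorBasis j) x) ^ 2 * max (-hA.eigenvalues j) 0 := by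
    have : ∑ j, (inner ℝ (hA.eigenvectorBasis j) x) ^ 2 * (-hA.eigenvalues j) ≤
        ∑ j, (inner ℝ (hA.eigenvectorBasis j) x) ^ 2 * max (-hA.eigenvalues j) 0 :=
      Finset.sum_le_sum fun j _ => mul_le_mul_of_nonneg_left (le_max_left _ _) (sq_nonneg _)
    simp only [mul_neg, Finset.sum_neg_distrib] at this
    linarith
  calc t ^ p ≤ (∑ j, (inner ℝ (hA.eigenvectorBasis j) x) ^ 2 *
        max (-hA.eigenvalues j) 0) ^ p := Real.rpow_le_rpow ht h1 (by linarith)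
    _ ≤ _ := Real.rpow_arith_mean_le_arith_mean_rpow _ _ _ (fun j _ => sq_nonneg _) hsum
        (fun j _ => le_max_right _ _) hp

lemma HasRayleighBound.le_gNegEnergy {S : Finset V} {c : ℝ} (h : G.HasRayleighBound S c)
    {p : ℝ} (hp : 4 ≤ p) : c ≤ gNegEnergy G p := by
  obtain ⟨ι, _, u, τ, -, h0, horth, hτ, hc⟩ := h
  set hA := adjMatrix_isHermitian G
  have hpos : ∀ i, 0 < u i ⬝ᵥ u i := fun i => by
    simpa using dotProduct_star_self_pos_iff.2 (h0 i)
  let x : ι → EuclideanSpace ℝ V := fun i => WithLp.toLp 2 ((√(u i ⬝ᵥ u i))⁻¹ • u i)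
  have hinner : ∀ i j, inner ℝ (x i) (x j) =
      (√(u i ⬝ᵥ u i))⁻¹ * (√(u j ⬝ᵥ u j))⁻¹ * (u i ⬝ᵥ u j) := fun i j => by
    simp only [x, EuclideanSpace.inner_eq_star_dotProduct, star_trivial, smul_dotProduct,
      dotProduct_smul, smul_eq_mul]
    rw [dotProduct_comm (u j) (u i)]; ring
  have hself : ∀ i, (√(u i ⬝ᵥ u i))⁻¹ * (√(u i ⬝ᵥ u i))⁻¹ * (u i ⬝ᵥ u i) = 1 := fun i => by
    rw [← mul_inv, Real.mul_self_sqrt (hpos i).le, inv_mul_cancel₀ (hpos i).ne']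
  have hx : Orthonormal ℝ x := by
    rw [orthonormal_iff_ite]
    intro i j
    rw [hinner]
    split_ifs with hij
    · subst hij; exact hself i
    · rw [horth i j hij, mul_zero]
  have hbessel : ∀ j, ∑ i, (inner ℝ (hA.eigenvectorBasis j) (x i)) ^ 2 ≤ 1 := fun j => by
    have := hx.sum_inner_products_le (hA.eigenvectorBasis j) (s := Finset.univ)
    simpa [real_inner_comm] using this
  have hray : ∀ i, τ i ^ 4 ≤ ∑ j, (inner ℝ (hA.eigenvectorBasis j) (x i)) ^ 2 *
      max (-hA.eigenvalues j) 0 ^ p := fun i => by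
    have h1 : τ i ^ 4 ≤ τ i ^ p := by
      have := Real.rpow_le_rpow_of_exponent_le (hτ i).1 hp
      exact_mod_cast this
    refine h1.trans (rpow_le_sum_of_rayleigh_le hA (by linarith) (by linarith [(hτ i).1]) (x i)
      (hx.1 i) ?_)
    simp only [x, mulVec_smul, smul_dotProduct, dotProduct_smul, smul_eq_mul]
    have h2 := mul_le_mul_of_nonneg_left (hτ i).2
      (mul_self_nonneg (√(u i ⬝ᵥ u i))⁻¹)
    linear_combination h2 - τ i * hself i
  calc c ≤ ∑ i, τ i ^ 4 := hc
    _ ≤ ∑ i, ∑ j, (inner ℝ (hA.eigenvectorBasis j) (x i)) ^ 2 *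
        max (-hA.eigenvalues j) 0 ^ p := Finset.sum_le_sum fun i _ => hray i
    _ = ∑ j, (∑ i, (inner ℝ (hA.eigenvectorBasis j) (x i)) ^ 2) *
        max (-hA.eigenvalues j) 0 ^ p := by
      rw [Finset.sum_comm]; simp only [Finset.sum_mul]
    _ ≤ ∑ j, max (-hA.eigenvalues j) 0 ^ p := Finset.sum_le_sum fun j _ =>
      mul_le_of_le_one_left (Real.rpow_nonneg (le_max_right _ _) _) (hbessel j)
    _ = gNegEnergy G p := by
      refine Finset.sum_congr rfl fun j _ => ?_
      split_ifs with hj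
      · rw [abs_of_neg hj, max_eq_left (by linarith)]
      · rw [max_eq_right (by linarith), Real.zero_rpow (by linarith)]

lemma HasRayleighBound.mono {S T : Finset V} {c d : ℝ} (h : G.HasRayleighBound S c) (hST : S ⊆ T)
    (hdc : d ≤ c) : G.HasRayleighBound T d := by
  obtain ⟨ι, _, u, τ, hs, h0, horth, hτ, hc⟩ := h
  exact ⟨ι, _, u, τ, fun i v hv => hs i v fun hv' => hv (hST hv'), h0, horth, hτ, hdc.trans hc⟩

lemma HasRayleighBound.zero (S : Finset V) : G.HasRayleighBound S 0 :=
  ⟨Empty, inferInstance, fun i => i.elim, fun i => i.elim, fun i => i.elim, fun i => i.elim,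
    fun i => i.elim, fun i => i.elim, by simp⟩

lemma HasRayleighBound.union {S T : Finset V} {c d : ℝ} (hS : G.HasRayleighBound S c)
    (hT : G.HasRayleighBound T d) (hST : Disjoint S T) : G.HasRayleighBound (S ∪ T) (c + d) := by
  obtain ⟨ι, _, u, τ, hs, h0, horth, hτ, hc⟩ := hS
  obtain ⟨κ, _, w, σ, hs', h0', horth', hσ, hd⟩ := hT
  have hcross : ∀ i j, u i ⬝ᵥ w j = 0 := fun i j => by
    refine Finset.sum_eq_zero fun v _ => ?_
    by_cases hv : v ∈ S
    · rw [hs' j v (Finset.disjoint_left.1 hST hv), mul_zero]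
    · rw [hs i v hv, zero_mul]
  refine ⟨ι ⊕ κ, inferInstance, Sum.elim u w, Sum.elim τ σ, ?_, ?_, ?_, ?_, ?_⟩
  · rintro (i | i) v hv <;> rw [Finset.mem_union, not_or] at hv
    · exact hs i v hv.1
    · exact hs' i v hv.2
  · rintro (i | i)
    exacts [h0 i, h0' i]
  · rintro (i | i) (j | j) hij
    · exact horth i j (by simpa using hij)
    · exact hcross i j
    · simpa [dotProduct_comm] using hcross j i
    · exact horth' i j (by simpa using hij)
  · rintro (i | i)
    exacts [hτ i, hσ i]
  · simpa using add_le_add hc hd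

/-- Vectors on an induced subgraph, extended by zero. -/
lemma HasRayleighBound.of_injective {k m : ℕ} (e : Fin k → V) (he : Function.Injective e)
    {S : Finset V} (hS : ∀ i, e i ∈ S) (w : Fin m → Fin k → ℝ) (τ : Fin m → ℝ)
    (h0 : ∀ i, 0 < w i ⬝ᵥ w i) (horth : ∀ i j, i ≠ j → w i ⬝ᵥ w j = 0)
    (hτ : ∀ i, 1 ≤ τ i ∧ ∑ a, ∑ b, (if G.Adj (e a) (e b) then w i a * w i b else 0) ≤
      -τ i * (w i ⬝ᵥ w i)) {c : ℝ} (hc : c ≤ ∑ i, τ i ^ 4) : G.HasRayleighBound S c := by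
  let u : Fin m → V → ℝ := fun i v => ∑ a, if e a = v then w i a else 0
  have hu : ∀ i (g : V → ℝ), u i ⬝ᵥ g = ∑ a, w i a * g (e a) := fun i g => by
    simp only [u, dotProduct, Finset.sum_mul]
    rw [Finset.sum_comm]
    simp [ite_mul]
  have hue : ∀ i a, u i (e a) = w i a := fun i a => by simp [u, he.eq_iff]
  have hdot : ∀ i j, u i ⬝ᵥ u j = w i ⬝ᵥ w j := fun i j => by
    rw [hu]; simp only [hue]; rfl
  refine ⟨Fin m, inferInstance, u, τ, ?_, ?_, ?_, ?_, hc⟩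
  · intro i v hv
    refine Finset.sum_eq_zero fun a _ => if_neg ?_
    rintro rfl
    exact hv (hS a)
  · intro i hi
    have := h0 i
    rw [← hdot, hi] at this
    simp at this
  · intro i j hij
    rw [hdot, horth i j hij]
  · intro i
    refine ⟨(hτ i).1, ?_⟩
    rw [hdot]
    convert (hτ i).2 using 1
    rw [hu]
    refine Finset.sum_congr rfl fun a _ => ?_
    have : (G.adjMatrix ℝ *ᵥ u i) (e a) = u i ⬝ᵥ (fun v => if G.Adj (e a) v then 1 else 0) := by
      simp only [mulVec, dotProduct_comm (u i)]
      congr 1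
    rw [this, hu, Finset.mul_sum]
    refine Finset.sum_congr rfl fun b _ => ?_
    split_ifs <;> simp

lemma exists_orthogonal_sum_zero (Q : Finset V) (hQ : Q.Nonempty) :
    ∃ (ι : Type) (_ : Fintype ι) (u : ι → V → ℝ), (∀ i, ∀ v ∉ Q, u i v = 0) ∧ (∀ i, u i ≠ 0) ∧
      (∀ i j, i ≠ j → u i ⬝ᵥ u j = 0) ∧ (∀ i, ∑ v, u i v = 0) ∧ Fintype.card ι + 1 = #Q := by
  induction hQ using Finset.Nonempty.cons_induction with
  | singleton a =>
    exact ⟨Empty, inferInstance, fun i => i.elim, fun i => i.elim, fun i => i.elim,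
      fun i => i.elim, fun i => i.elim, by simp⟩
  | cons a s ha hs ih =>
    obtain ⟨ι, _, u, hsupp, h0, horth, hsum, hcard⟩ := ih
    let w : V → ℝ := fun v => if v = a then (#s : ℝ) else if v ∈ s then -1 else 0
    have hw : ∀ i, u i ⬝ᵥ w = 0 := fun i => by
      have : u i ⬝ᵥ w = -∑ v, u i v := by
        rw [← Finset.sum_neg_distrib]
        refine Finset.sum_congr rfl fun v _ => ?_
        by_cases hva : v = a
        · subst hva; simp [hsupp i v ha]
        · by_cases hvs : v ∈ s
          · simp [w, hva, hvs]
          · simp [w, hva, hvs, hsupp i v hvs]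
      rw [this, hsum, neg_zero]
    refine ⟨Option ι, inferInstance, fun i => i.elim w u, ?_, ?_, ?_, ?_, ?_⟩
    · rintro (_ | i) v hv <;> rw [Finset.mem_cons, not_or] at hv
      · simp [w, hv.1, hv.2]
      · exact hsupp i v hv.2
    · rintro (_ | i)
      · intro h
        have := congrFun h a
        simp [w] at this
        exact hs.ne_empty this
      · exact h0 i
    · rintro (_ | i) (_ | j) hij
      · exact absurd rfl hij
      · simpa [dotProduct_comm] using hw j
      · exact hw i
      · exact horth i j (by simpa using hij)
    · rintro (_ | i)
      · have : ∀ v, w v = (if v = a then (#s : ℝ) else 0) + (if v ∈ s then -1 else 0) := by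
          intro v
          by_cases hva : v = a
          · subst hva; simp [w, ha]
          · simp [w, hva]
        simp [this, Finset.sum_add_distrib]
      · exact hsum i
    · simp [hcard, -Finset.cons_eq_insert]

lemma HasRayleighBound.of_isClique {Q : Finset V}
    (hQ : ∀ a ∈ Q, ∀ b ∈ Q, a ≠ b → G.Adj a b) : G.HasRayleighBound Q (#Q - 1) := by
  rcases Q.eq_empty_or_nonempty with rfl | hne
  · exact (HasRayleighBound.zero _).mono subset_rfl (by simp)
  obtain ⟨ι, _, u, hs, h0, horth, hsum, hcard⟩ := exists_orthogonal_sum_zero Q hne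
  refine ⟨ι, inferInstance, u, fun _ => 1, hs, h0, horth, fun i => ⟨le_rfl, ?_⟩, ?_⟩
  · have key : ∀ v, u i v * (G.adjMatrix ℝ *ᵥ u i) v = -(u i v * u i v) := fun v => by
      by_cases hv : v ∈ Q
      · have : (G.adjMatrix ℝ *ᵥ u i) v = ∑ w, (u i w - if w = v then u i w else 0) := by
          refine Finset.sum_congr rfl fun w _ => ?_
          by_cases hw : w ∈ Q
          · by_cases hwv : w = v
            · subst hwv; simp
            · simp [hwv, hQ v hv w hw (Ne.symm hwv)]
          · simp [hs i w hw]
        rw [this, Finset.sum_sub_distrib, hsum]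
        simp
      · simp [hs i v hv]
    rw [neg_one_mul, dotProduct, dotProduct, Finset.sum_congr rfl fun v _ => key v,
      Finset.sum_neg_distrib]
  · rw [← hcard]; simp

lemma HasRayleighBound.of_star {c : V} {L : Finset V} (hL : L.Nonempty)
    (hadj : ∀ l ∈ L, G.Adj c l) (hind : ∀ l ∈ L, ∀ l' ∈ L, ¬G.Adj l l') :
    G.HasRayleighBound (insert c L) ((#L : ℝ) ^ 2) := by
  have hc : c ∉ L := fun h => G.irrefl (hadj c h)
  have h1 : (1 : ℝ) ≤ #L := by exact_mod_cast hL.card_pos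
  set t : ℝ := √(#L) with ht
  have ht2 : t ^ 2 = #L := Real.sq_sqrt (by linarith)
  have ht1 : 1 ≤ t := Real.one_le_sqrt.2 h1
  let u : V → ℝ := fun v => (if v = c then t else 0) + (if v ∈ L then -1 else 0)
  have hdot : ∀ g : V → ℝ, u ⬝ᵥ g = t * g c - ∑ l ∈ L, g l := fun g => by
    simp [u, dotProduct, add_mul, Finset.sum_add_distrib, ite_mul, Finset.sum_ite_mem,
      sub_eq_add_neg]
  have huc : u c = t := by simp [u, hc]
  have hul : ∀ l ∈ L, u l = -1 := fun l hl => by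
    have : l ≠ c := fun h => hc (h ▸ hl)
    simp [u, hl, this]
  have hmul : ∀ v, (G.adjMatrix ℝ *ᵥ u) v =
      t * (if G.Adj v c then 1 else 0) - ∑ l ∈ L, if G.Adj v l then 1 else 0 := fun v => by
    have : (G.adjMatrix ℝ *ᵥ u) v = u ⬝ᵥ (fun w => if G.Adj v w then 1 else 0) := by
      simp only [mulVec, dotProduct_comm u]
      congr 1
    rw [this, hdot]
  have hAc : (G.adjMatrix ℝ *ᵥ u) c = -#L := by
    rw [hmul, Finset.sum_congr rfl fun l hl => if_pos (hadj l hl)]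
    simp
  have hAl : ∀ l ∈ L, (G.adjMatrix ℝ *ᵥ u) l = t := fun l hl => by
    rw [hmul, Finset.sum_congr rfl fun l' hl' => if_neg (hind l hl l' hl')]
    simp [(hadj l hl).symm]
  refine ⟨Unit, inferInstance, fun _ => u, fun _ => t, ?_, ?_, ?_, ?_, ?_⟩
  · intro _ v hv
    rw [Finset.mem_insert, not_or] at hv
    simp [u, hv.1, hv.2]
  · intro _ h
    have := congrFun h c
    simp only [huc, Pi.zero_apply] at this
    linarith
  · intro i j hij
    exact absurd rfl hij
  · intro _
    refine ⟨ht1, ?_⟩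
    beta_reduce
    rw [hdot, hdot, hAc, Finset.sum_congr rfl hAl, Finset.sum_congr rfl hul, huc]
    simp only [Finset.sum_const, nsmul_eq_mul, ← ht2]
    nlinarith
  · simp [← ht2]
    nlinarith

lemma HasRayleighBound.of_labels {κ : Type*} [DecidableEq κ] (c : V → κ) (I : Finset κ)
    (T : Finset V) (hc : ∀ t ∈ T, c t ∈ I)
    (hadj : ∀ t ∈ T, ∀ t' ∈ T, t ≠ t' → c t = c t' → G.Adj t t') :
    G.HasRayleighBound T (#T - #I) := by
  induction I using Finset.induction_on generalizing T with
  | empty =>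
    have : T = ∅ := Finset.eq_empty_of_forall_notMem fun t ht => by simpa using hc t ht
    subst this
    simpa using HasRayleighBound.zero ∅
  | insert i I hi ih =>
    have h1 := ih (T.filter fun t => c t ≠ i) (fun t ht => by
        rw [Finset.mem_filter] at ht
        exact (Finset.mem_insert.1 (hc t ht.1)).resolve_left ht.2)
      (fun t ht t' ht' => hadj t (Finset.mem_filter.1 ht).1 t' (Finset.mem_filter.1 ht').1)
    have h2 : G.HasRayleighBound (T.filter fun t => c t = i) _ :=
      HasRayleighBound.of_isClique fun t ht t' ht' hne => by
        rw [Finset.mem_filter] at ht ht'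
        exact hadj t ht.1 t' ht'.1 hne (ht.2.trans ht'.2.symm)
    have hcard := Finset.card_filter_add_card_filter_not (s := T) (fun t => c t = i)
    refine (h2.union h1 (Finset.disjoint_filter_filter_not _ _ _)).mono ?_ ?_
    · rw [Finset.filter_union_filter_not_eq]
    · rw [Finset.card_insert_of_notMem hi, ← hcard]
      push_cast
      linarith


/-- An induced path on four vertices. -/
lemma HasRayleighBound.of_path_four {a b c d : V} {S : Finset V}
    (ha : a ∈ S) (hb : b ∈ S) (hc : c ∈ S) (hd : d ∈ S)
    (hab : G.Adj a b) (hbc : G.Adj b c) (hcd : G.Adj c d)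
    (hac : ¬G.Adj a c) (had : ¬G.Adj a d) (hbd : ¬G.Adj b d) : G.HasRayleighBound S 6 := by
  have nab := hab.ne
  have nbc := hbc.ne
  have ncd := hcd.ne
  have nac : a ≠ c := by rintro rfl; simp_all
  have nad : a ≠ d := by rintro rfl; simp_all [G.adj_comm]
  have nbd : b ≠ d := by rintro rfl; simp_all
  refine HasRayleighBound.of_injective ![a, b, c, d] ?_ ?_
    ![![2, -3, 3, -2]] ![8 / 5] ?_ ?_ ?_ ?_
  · intro i j h
    fin_cases i <;> fin_cases j <;> simp_all
  · intro i
    fin_cases i <;> assumption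
  · intro i
    fin_cases i <;> norm_num [dotProduct, Fin.sum_univ_succ]
  · exact fun i j hij => absurd (Subsingleton.elim i j) hij
  · intro i
    fin_cases i <;> norm_num [dotProduct, Fin.sum_univ_succ, hab, hbc, hcd, hac, had, hbd,
        hab.symm, hbc.symm, hcd.symm, mt Adj.symm hac, mt Adj.symm had, mt Adj.symm hbd]
  · norm_num [Fin.sum_univ_succ]

/-- An induced cycle on four vertices. -/
lemma HasRayleighBound.of_cycle_four {a b c d : V} {S : Finset V}
    (ha : a ∈ S) (hb : b ∈ S) (hc : c ∈ S) (hd : d ∈ S)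
    (hab : G.Adj a b) (had : G.Adj a d) (hbc : G.Adj b c) (hcd : G.Adj c d)
    (hac : ¬G.Adj a c) (hbd : ¬G.Adj b d)
    (nac : a ≠ c) (nbd : b ≠ d) : G.HasRayleighBound S 16 := by
  have nab := hab.ne
  have nad := had.ne
  have nbc := hbc.ne
  have ncd := hcd.ne
  refine HasRayleighBound.of_injective ![a, b, c, d] ?_ ?_
    ![![1, -1, 1, -1]] ![2] ?_ ?_ ?_ ?_
  · intro i j h
    fin_cases i <;> fin_cases j <;> simp_all
  · intro i
    fin_cases i <;> assumption
  · intro i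
    fin_cases i <;> norm_num [dotProduct, Fin.sum_univ_succ]
  · exact fun i j hij => absurd (Subsingleton.elim i j) hij
  · intro i
    fin_cases i <;> norm_num [dotProduct, Fin.sum_univ_succ, hab, had, hbc, hcd, hac, hbd,
        hab.symm, had.symm, hbc.symm, hcd.symm, mt Adj.symm hac, mt Adj.symm hbd]
  · norm_num [Fin.sum_univ_succ]

/-- An induced complete graph on four vertices minus the edge `bd`. -/
lemma HasRayleighBound.of_diamond {a b c d : V} {S : Finset V}
    (ha : a ∈ S) (hb : b ∈ S) (hc : c ∈ S) (hd : d ∈ S)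
    (hab : G.Adj a b) (hac : G.Adj a c) (had : G.Adj a d) (hbc : G.Adj b c) (hcd : G.Adj c d)
    (hbd : ¬G.Adj b d)
    (nbd : b ≠ d) : G.HasRayleighBound S 6 := by
  have nab := hab.ne
  have nac := hac.ne
  have nad := had.ne
  have nbc := hbc.ne
  have ncd := hcd.ne
  refine HasRayleighBound.of_injective ![a, b, c, d] ?_ ?_
    ![![1, 0, -1, 0], ![4, -5, 4, -5]] ![1, 3 / 2] ?_ ?_ ?_ ?_
  · intro i j h
    fin_cases i <;> fin_cases j <;> simp_all
  · intro i
    fin_cases i <;> assumption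
  · intro i
    fin_cases i <;> norm_num [dotProduct, Fin.sum_univ_succ]
  · intro i j hij
    fin_cases i <;> fin_cases j <;>
      first | exact absurd rfl hij | norm_num [dotProduct, Fin.sum_univ_succ]
  · intro i
    fin_cases i <;> norm_num [dotProduct, Fin.sum_univ_succ, hab, hac, had, hbc, hcd, hbd,
        hab.symm, hac.symm, had.symm, hbc.symm, hcd.symm, mt Adj.symm hbd]
  · norm_num [Fin.sum_univ_succ]

/-- Two induced triangles sharing the vertex `a`. -/
lemma HasRayleighBound.of_butterfly {a b c d e : V} {S : Finset V}
    (ha : a ∈ S) (hb : b ∈ S) (hc : c ∈ S) (hd : d ∈ S) (he : e ∈ S)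
    (hab : G.Adj a b) (hac : G.Adj a c) (had : G.Adj a d) (hae : G.Adj a e) (hbc : G.Adj b c) (hde : G.Adj d e)
    (hbd : ¬G.Adj b d) (hbe : ¬G.Adj b e) (hcd : ¬G.Adj c d) (hce : ¬G.Adj c e) : G.HasRayleighBound S 7 := by
  have nab := hab.ne
  have nac := hac.ne
  have nad := had.ne
  have nae := hae.ne
  have nbc := hbc.ne
  have nde := hde.ne
  have nbd : b ≠ d := by rintro rfl; simp_all
  have nbe : b ≠ e := by rintro rfl; simp_all [G.adj_comm]
  have ncd : c ≠ d := by rintro rfl; simp_all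
  have nce : c ≠ e := by rintro rfl; simp_all
  refine HasRayleighBound.of_injective ![a, b, c, d, e] ?_ ?_
    ![![0, 1, -1, 0, 0], ![0, 0, 0, 1, -1], ![5, -2, -2, -2, -2]] ![1, 1, 3 / 2] ?_ ?_ ?_ ?_
  · intro i j h
    fin_cases i <;> fin_cases j <;> simp_all
  · intro i
    fin_cases i <;> assumption
  · intro i
    fin_cases i <;> norm_num [dotProduct, Fin.sum_univ_succ]
  · intro i j hij
    fin_cases i <;> fin_cases j <;>
      first | exact absurd rfl hij | norm_num [dotProduct, Fin.sum_univ_succ]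
  · intro i
    fin_cases i <;> norm_num [dotProduct, Fin.sum_univ_succ, hab, hac, had, hae, hbc, hde, hbd,
        hbe, hcd, hce, hab.symm, hac.symm, had.symm, hae.symm, hbc.symm, hde.symm,
        mt Adj.symm hbd, mt Adj.symm hbe, mt Adj.symm hcd, mt Adj.symm hce]
  · norm_num [Fin.sum_univ_succ]

/-- An induced path `abc` with a triangle attached at `c`. -/
lemma HasRayleighBound.of_lollipop {a b c d e : V} {S : Finset V}
    (ha : a ∈ S) (hb : b ∈ S) (hc : c ∈ S) (hd : d ∈ S) (he : e ∈ S)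
    (hab : G.Adj a b) (hbc : G.Adj b c) (hcd : G.Adj c d) (hce : G.Adj c e) (hde : G.Adj d e)
    (hac : ¬G.Adj a c) (had : ¬G.Adj a d) (hae : ¬G.Adj a e) (hbd : ¬G.Adj b d) (hbe : ¬G.Adj b e) : G.HasRayleighBound S 8 := by
  have nab := hab.ne
  have nbc := hbc.ne
  have ncd := hcd.ne
  have nce := hce.ne
  have nde := hde.ne
  have nac : a ≠ c := by rintro rfl; simp_all
  have nad : a ≠ d := by rintro rfl; simp_all
  have nae : a ≠ e := by rintro rfl; simp_all [G.adj_comm]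
  have nbd : b ≠ d := by rintro rfl; simp_all
  have nbe : b ≠ e := by rintro rfl; simp_all
  refine HasRayleighBound.of_injective ![a, b, c, d, e] ?_ ?_
    ![![0, 0, 0, 1, -1], ![4, -7, 8, -3, -3]] ![1, 33 / 20] ?_ ?_ ?_ ?_
  · intro i j h
    fin_cases i <;> fin_cases j <;> simp_all
  · intro i
    fin_cases i <;> assumption
  · intro i
    fin_cases i <;> norm_num [dotProduct, Fin.sum_univ_succ]
  · intro i j hij
    fin_cases i <;> fin_cases j <;>
      first | exact absurd rfl hij | norm_num [dotProduct, Fin.sum_univ_succ]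
  · intro i
    fin_cases i <;> norm_num [dotProduct, Fin.sum_univ_succ, hab, hbc, hcd, hce, hde, hac, had,
        hae, hbd, hbe, hab.symm, hbc.symm, hcd.symm, hce.symm, hde.symm, mt Adj.symm hac,
        mt Adj.symm had, mt Adj.symm hae, mt Adj.symm hbd, mt Adj.symm hbe]
  · norm_num [Fin.sum_univ_succ]

variable (G) in
/-- Every proper nonempty part of `S` sends an edge to the rest of `S`. -/
def CutConnected (S : Finset V) : Prop :=
  ∀ T ⊆ S, T.Nonempty → T ≠ S → ∃ u ∈ T, ∃ v ∈ S \ T, G.Adj u v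

variable (G) in
/-- `x y z` is an induced path with middle vertex `y`. -/
structure IsCherry (x y z : V) : Prop where
  left : G.Adj x y
  right : G.Adj y z
  ne : x ≠ z
  not_adj : ¬G.Adj x z

lemma IsCherry.symm {x y z : V} (h : G.IsCherry x y z) : G.IsCherry z y x :=
  ⟨h.right.symm, h.left.symm, h.ne.symm, mt Adj.symm h.not_adj⟩

lemma CutConnected.insert_of_adj {S : Finset V} (hS : G.CutConnected S) {u v : V} (hu : u ∈ S)
    (huv : G.Adj u v) : G.CutConnected (insert v S) := by
  intro T hT hne hTS
  by_cases h0 : T ∩ S = ∅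
  · have hTv : T = {v} := by
      refine Finset.eq_singleton_iff_nonempty_unique_mem.2 ⟨hne, fun t ht => ?_⟩
      refine (Finset.mem_insert.1 (hT ht)).resolve_right fun hts => ?_
      exact Finset.notMem_empty t (h0 ▸ Finset.mem_inter.2 ⟨ht, hts⟩)
    subst hTv
    refine ⟨v, Finset.mem_singleton_self v, u, ?_, huv.symm⟩
    simp [hu, huv.ne]
  by_cases h1 : T ∩ S = S
  · have hST : S ⊆ T := Finset.inter_eq_right.1 h1
    have hvT : v ∉ T := fun h => hTS (hT.antisymm (Finset.insert_subset h hST))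
    exact ⟨u, hST hu, v, by simp [hvT], huv⟩
  · obtain ⟨a, ha, b, hb, hab⟩ := hS (T ∩ S) Finset.inter_subset_right
      (Finset.nonempty_iff_ne_empty.2 h0) h1
    simp only [Finset.mem_inter, Finset.mem_sdiff] at ha hb
    exact ⟨a, ha.1, b, by simp [hb.1]; tauto, hab⟩

lemma IsCherry.cutConnected {x y z : V} (h : G.IsCherry x y z) : G.CutConnected {x, y, z} := by
  have h1 : G.CutConnected ({z} : Finset V) := fun T hT hne hTz =>
    absurd ((Finset.subset_singleton_iff.1 hT).resolve_left hne.ne_empty) hTz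
  have h2 := h1.insert_of_adj (Finset.mem_singleton_self z) h.right.symm
  exact h2.insert_of_adj (Finset.mem_insert_self y _) h.left.symm

lemma CutConnected.exists_partition {S : Finset V} (hS : G.CutConnected S) (A B : Finset V)
    (hA : A ⊆ S) (hB : B ⊆ S) (hAB : Disjoint A B) (hne : A.Nonempty)
    (hcA : G.CutConnected A) (hcB : G.CutConnected B) :
    ∃ A' B', A ⊆ A' ∧ B ⊆ B' ∧ Disjoint A' B' ∧ A' ∪ B' = S ∧
      G.CutConnected A' ∧ G.CutConnected B' := by
  induction hk : #(S \ (A ∪ B)) using Nat.strong_induction_on generalizing A B with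
  | _ k ih =>
  by_cases hAB' : A ∪ B = S
  · exact ⟨A, B, subset_rfl, subset_rfl, hAB, hAB', hcA, hcB⟩
  obtain ⟨u, hu, v, hv, huv⟩ := hS (A ∪ B) (Finset.union_subset hA hB)
    (hne.mono Finset.subset_union_left) hAB'
  have hv' := hv
  rw [Finset.mem_sdiff, Finset.mem_union, not_or] at hv'
  have hlt : #(S \ insert v (A ∪ B)) < k := by
    rw [← hk, Finset.sdiff_insert]
    exact Finset.card_erase_lt_of_mem hv
  rcases Finset.mem_union.1 hu with hu | hu
  · obtain ⟨A', B', h1, h2, h3⟩ := ih _ hlt (insert v A) B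
      (Finset.insert_subset hv'.1 hA) hB (Finset.disjoint_insert_left.2 ⟨hv'.2.2, hAB⟩)
      (Finset.insert_nonempty _ _) (hcA.insert_of_adj hu huv) hcB
      (by rw [Finset.insert_union])
    exact ⟨A', B', (Finset.subset_insert _ _).trans h1, h2, h3⟩
  · obtain ⟨A', B', h1, h2, h3⟩ := ih _ hlt A (insert v B)
      hA (Finset.insert_subset hv'.1 hB) (Finset.disjoint_insert_right.2 ⟨hv'.2.1, hAB⟩)
      hne hcA (hcB.insert_of_adj hu huv)
      (by rw [Finset.union_insert])
    exact ⟨A', B', h1, (Finset.subset_insert _ _).trans h2, h3⟩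

variable (G) in
/-- An induced path `x y z` in `S` such that `S` has no two disjoint induced paths on three
vertices; the rest of `S` is a disjoint union of cliques, labelled by `c` with labels in a set `I`
of representatives, each of which has a neighbour on the path. -/
structure CherryCover (S I : Finset V) (c : V → V) (x y z : V) : Prop extends
    G.IsCherry x y z where
  mem_left : x ∈ S
  mem_mid : y ∈ S
  mem_right : z ∈ S
  mem_of_mem : ∀ i ∈ I, i ∈ S
  ne_left : ∀ i ∈ I, i ≠ x
  ne_mid : ∀ i ∈ I, i ≠ y
  ne_right : ∀ i ∈ I, i ≠ z
  indep : ∀ i ∈ I, ∀ j ∈ I, ¬G.Adj i j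
  attached : ∀ i ∈ I, G.Adj i x ∨ G.Adj i y ∨ G.Adj i z
  label_mem : ∀ r ∈ S, r ≠ x → r ≠ y → r ≠ z → c r ∈ I
  adj_of_label : ∀ r ∈ S, r ≠ x → r ≠ y → r ≠ z → ∀ r' ∈ S, r' ≠ x → r' ≠ y → r' ≠ z →
    r ≠ r' → c r = c r' → G.Adj r r'
  not_disjoint : ∀ a ∈ S, ∀ b ∈ S, ∀ d ∈ S, ∀ a' ∈ S, ∀ b' ∈ S, ∀ d' ∈ S,
    G.IsCherry a b d → G.IsCherry a' b' d' → ¬Disjoint ({a, b, d} : Finset V) {a', b', d'}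

lemma CutConnected.exists_cherryCover {S : Finset V} (hS : G.CutConnected S) {x y z : V}
    (hx : x ∈ S) (hy : y ∈ S) (hz : z ∈ S) (h : G.IsCherry x y z)
    (hirr : ∀ a ∈ S, ∀ b ∈ S, ∀ d ∈ S, ∀ a' ∈ S, ∀ b' ∈ S, ∀ d' ∈ S,
      G.IsCherry a b d → G.IsCherry a' b' d' → ¬Disjoint ({a, b, d} : Finset V) {a', b', d'}) :
    ∃ I c, G.CherryCover S I c x y z := by
  set R := S \ {x, y, z} with hR
  have hmemR : ∀ r, r ∈ R ↔ r ∈ S ∧ r ≠ x ∧ r ≠ y ∧ r ≠ z := fun r => by simp [hR]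
  have htrans : ∀ a ∈ R, ∀ b ∈ R, ∀ d ∈ R, (a = b ∨ G.Adj a b) → (b = d ∨ G.Adj b d) →
      (a = d ∨ G.Adj a d) := by
    intro a ha b hb d hd hab hbd
    by_contra hcon
    rw [not_or] at hcon
    rcases hab with rfl | hab
    · exact (not_or.2 hcon) hbd
    rcases hbd with rfl | hbd
    · exact hcon.2 hab
    rw [hmemR] at ha hb hd
    refine hirr x hx y hy z hz a ha.1 b hb.1 d hd.1 h ⟨hab, hbd, hcon.1, hcon.2⟩ ?_
    simp only [Finset.disjoint_insert_right, Finset.disjoint_singleton_right, Finset.mem_insert,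
      Finset.mem_singleton]
    tauto
  have hatt : ∀ r ∈ R, ∃ q ∈ R, (r = q ∨ G.Adj r q) ∧ (G.Adj q x ∨ G.Adj q y ∨ G.Adj q z) := by
    intro r hr
    obtain ⟨u, hu, v, hv, huv⟩ := hS (R.filter fun q => r = q ∨ G.Adj r q)
      ((Finset.filter_subset _ _).trans Finset.sdiff_subset)
      ⟨r, Finset.mem_filter.2 ⟨hr, Or.inl rfl⟩⟩
      (fun he => by
        have : x ∈ R := (Finset.mem_filter.1 (he ▸ hx)).1
        simp [hR] at this)
    rw [Finset.mem_filter] at hu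
    rw [Finset.mem_sdiff] at hv
    refine ⟨u, hu.1, hu.2, ?_⟩
    by_cases hvR : v ∈ R
    · exact absurd (Finset.mem_filter.2 ⟨hvR, htrans r hr u hu.1 v hvR hu.2 (Or.inr huv)⟩) hv.2
    · rw [hmemR] at hvR
      by_contra hcon
      have : v ≠ x ∧ v ≠ y ∧ v ≠ z := by
        refine ⟨?_, ?_, ?_⟩ <;> rintro rfl <;> tauto
      tauto
  let F := (R.filter fun q => G.Adj q x ∨ G.Adj q y ∨ G.Adj q z).powerset.filter
    fun J => ∀ i ∈ J, ∀ j ∈ J, ¬G.Adj i j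
  obtain ⟨I, hIF, hmax⟩ := F.exists_max_image (fun J => #J) ⟨∅, by simp [F]⟩
  simp only [F, Finset.mem_filter, Finset.mem_powerset] at hIF hmax
  have hI : ∀ i ∈ I, i ∈ R ∧ (G.Adj i x ∨ G.Adj i y ∨ G.Adj i z) := fun i hi =>
    Finset.mem_filter.1 (hIF.1 hi)
  have hcover : ∀ r ∈ R, ∃ i ∈ I, r = i ∨ G.Adj r i := by
    intro r hr
    obtain ⟨q, hq, hrq, hqa⟩ := hatt r hr
    suffices ∃ i ∈ I, q = i ∨ G.Adj q i by
      obtain ⟨i, hi, hqi⟩ := this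
      exact ⟨i, hi, htrans r hr q hq i (hI i hi).1 hrq hqi⟩
    by_contra! hcon
    have hqI : q ∉ I := fun h => (hcon q h).1 rfl
    have := hmax (insert q I) ⟨Finset.insert_subset (Finset.mem_filter.2 ⟨hq, hqa⟩) hIF.1, by
      intro i hi j hj
      rw [Finset.mem_insert] at hi hj
      rcases hi with rfl | hi <;> rcases hj with rfl | hj
      · exact G.irrefl
      · exact (hcon j hj).2
      · exact mt Adj.symm (hcon i hi).2
      · exact hIF.2 i hi j hj⟩
    rw [Finset.card_insert_of_notMem hqI] at this
    omega
  choose! c hcI hc using hcover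
  refine ⟨I, c, ⟨h, hx, hy, hz, fun i hi => ((hmemR i).1 (hI i hi).1).1,
    fun i hi => ((hmemR i).1 (hI i hi).1).2.1, fun i hi => ((hmemR i).1 (hI i hi).1).2.2.1,
    fun i hi => ((hmemR i).1 (hI i hi).1).2.2.2, hIF.2, fun i hi => (hI i hi).2,
    fun r hr h1 h2 h3 => hcI r ((hmemR r).2 ⟨hr, h1, h2, h3⟩), ?_, hirr⟩⟩
  intro r hr h1 h2 h3 r' hr' h1' h2' h3' hne hcr
  have hrR := (hmemR r).2 ⟨hr, h1, h2, h3⟩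
  have hrR' := (hmemR r').2 ⟨hr', h1', h2', h3'⟩
  refine (htrans r hrR (c r) (hI _ (hcI r hrR)).1 r' hrR' (hc r hrR) ?_).resolve_left hne
  rw [hcr]
  exact (hc r' hrR').imp Eq.symm Adj.symm

namespace CherryCover

variable {S I : Finset V} {c : V → V} {x y z : V}

lemma symm (h : G.CherryCover S I c x y z) : G.CherryCover S I c z y x where
  toIsCherry := h.toIsCherry.symm
  mem_left := h.mem_right
  mem_mid := h.mem_mid
  mem_right := h.mem_left
  mem_of_mem := h.mem_of_mem
  ne_left := h.ne_right
  ne_mid := h.ne_mid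
  ne_right := h.ne_left
  indep := h.indep
  attached i hi := by have := h.attached i hi; tauto
  label_mem r hr h1 h2 h3 := h.label_mem r hr h3 h2 h1
  adj_of_label r hr h1 h2 h3 r' hr' h1' h2' h3' :=
    h.adj_of_label r hr h3 h2 h1 r' hr' h3' h2' h1'
  not_disjoint := h.not_disjoint

/-- A bound on `H` extends to `S` if it pays for the cliques outside `H`. The vertices of the
path outside `H` are split into cliques by the labels `g`. -/
lemma hasRayleighBound_of_subset (h : G.CherryCover S I c x y z) {H E : Finset V} {g : V → V}
    {b : ℝ} (hH : H ⊆ S) (hb : G.HasRayleighBound H b) (hE : E ⊆ {x, y, z})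
    (hgE : ∀ v ∈ ({x, y, z} : Finset V), v ∉ H → g v ∈ E)
    (hg : ∀ v ∈ ({x, y, z} : Finset V), ∀ w ∈ ({x, y, z} : Finset V), v ∉ H → w ∉ H → v ≠ w →
      g v = g w → G.Adj v w)
    (hcard : (#H + #I + #E : ℝ) ≤ b) : G.HasRayleighBound S #S := by
  have hIE : ∀ i ∈ I, i ∉ E := fun i hi hiE => by
    have := hE hiE
    simp [h.ne_left i hi, h.ne_mid i hi, h.ne_right i hi] at this
  let c' : V → V := fun v => if v ∈ ({x, y, z} : Finset V) then g v else c v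
  have hout : ∀ v, v ∉ ({x, y, z} : Finset V) → v ≠ x ∧ v ≠ y ∧ v ≠ z := fun v hv => by
    simpa using hv
  have hT : G.HasRayleighBound (S \ H) (#(S \ H) - #(I ∪ E)) := by
    refine HasRayleighBound.of_labels c' _ _ ?_ ?_
    · intro t ht
      rw [Finset.mem_sdiff] at ht
      by_cases hp : t ∈ ({x, y, z} : Finset V)
      · simp only [c', if_pos hp]
        exact Finset.mem_union_right _ (hgE t hp ht.2)
      · simp only [c', if_neg hp]
        obtain ⟨h1, h2, h3⟩ := hout t hp
        exact Finset.mem_union_left _ (h.label_mem t ht.1 h1 h2 h3)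
    · intro t ht t' ht' hne hcc
      rw [Finset.mem_sdiff] at ht ht'
      by_cases hp : t ∈ ({x, y, z} : Finset V) <;> by_cases hp' : t' ∈ ({x, y, z} : Finset V)
      · simp only [c', if_pos hp, if_pos hp'] at hcc
        exact hg t hp t' hp' ht.2 ht'.2 hne hcc
      · simp only [c', if_pos hp, if_neg hp'] at hcc
        obtain ⟨h1, h2, h3⟩ := hout t' hp'
        exact absurd (hcc ▸ hgE t hp ht.2) (hIE _ (h.label_mem t' ht'.1 h1 h2 h3))
      · simp only [c', if_neg hp, if_pos hp'] at hcc
        obtain ⟨h1, h2, h3⟩ := hout t hp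
        exact absurd (hcc ▸ hgE t' hp' ht'.2) (hIE _ (h.label_mem t ht.1 h1 h2 h3))
      · simp only [c', if_neg hp, if_neg hp'] at hcc
        obtain ⟨h1, h2, h3⟩ := hout t hp
        obtain ⟨h1', h2', h3'⟩ := hout t' hp'
        exact h.adj_of_label t ht.1 h1 h2 h3 t' ht'.1 h1' h2' h3' hne hcc
  refine (hb.union hT Finset.disjoint_sdiff).mono (Finset.union_sdiff_of_subset hH).le ?_
  have h1 : (#(S \ H) : ℝ) + #H = #S := by exact_mod_cast Finset.card_sdiff_add_card_eq_card hH
  have h2 : (#(I ∪ E) : ℝ) ≤ #I + #E := by exact_mod_cast Finset.card_union_le I E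
  linarith

lemma hasRayleighBound_of_superset (h : G.CherryCover S I c x y z) {H : Finset V} {b : ℝ}
    (hH : H ⊆ S) (hxH : x ∈ H) (hyH : y ∈ H) (hzH : z ∈ H) (hb : G.HasRayleighBound H b)
    (hcard : (#H + #I : ℝ) ≤ b) : G.HasRayleighBound S #S := by
  have hP : ∀ v ∈ ({x, y, z} : Finset V), v ∈ H := by simp [hxH, hyH, hzH]
  exact h.hasRayleighBound_of_subset (E := ∅) (g := id) hH hb (Finset.empty_subset _)
    (fun v hv hvH => absurd (hP v hv) hvH) (fun v hv _ _ hvH => absurd (hP v hv) hvH)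
    (by simpa using hcard)

lemma adj_of_two (h : G.CherryCover S I c x y z) {q q' o : V} (hq : q ∈ I) (hq' : q' ∈ I)
    (hne : q ≠ q') (hqx : G.Adj q x) (hqx' : G.Adj q' x) (ho : o ∈ I) (hox : ¬G.Adj o x) :
    G.Adj o y ∧ G.Adj o z := by
  have h1 : o ≠ q := fun e => hox (e ▸ hqx)
  have h2 : o ≠ q' := fun e => hox (e ▸ hqx')
  have := h.ne_left o ho
  have := h.ne_mid q hq
  have := h.ne_mid q' hq'
  have := h.ne_right q hq
  have := h.ne_right q' hq'
  have := h.left.ne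
  have := h.ne
  have hcherry : G.IsCherry q x q' := ⟨hqx, hqx'.symm, hne, h.indep q hq q' hq'⟩
  have hdisj : Disjoint ({q, x, q'} : Finset V) {o, y, z} := by
    simp only [Finset.disjoint_insert_right, Finset.disjoint_singleton_right, Finset.mem_insert,
      Finset.mem_singleton]
    tauto
  have hdisj' : Disjoint ({q, x, q'} : Finset V) {y, z, o} := by
    convert hdisj using 1
    ext v; simp; tauto
  have hmem := h.mem_of_mem
  rcases (h.attached o ho).resolve_left hox with hoy | hoz
  · refine ⟨hoy, by_contra fun hoz => ?_⟩
    exact h.not_disjoint q (hmem q hq) x h.mem_left q' (hmem q' hq') o (hmem o ho) y h.mem_mid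
      z h.mem_right hcherry ⟨hoy, h.right, h.ne_right o ho, hoz⟩ hdisj
  · refine ⟨by_contra fun hoy => ?_, hoz⟩
    exact h.not_disjoint q (hmem q hq) x h.mem_left q' (hmem q' hq') y h.mem_mid z h.mem_right
      o (hmem o ho) hcherry ⟨h.right, hoz.symm, (h.ne_mid o ho).symm, mt Adj.symm hoy⟩ hdisj'

lemma card_not_adj_le_one (h : G.CherryCover S I c x y z)
    (hI : 2 ≤ #(I.filter fun i => G.Adj i x)) : #(I.filter fun i => ¬G.Adj i x) ≤ 1 := by
  obtain ⟨q, hq, q', hq', hne⟩ := Finset.one_lt_card.1 hI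
  rw [Finset.mem_filter] at hq hq'
  rw [Finset.card_le_one]
  intro o ho o' ho'
  rw [Finset.mem_filter] at ho ho'
  by_contra hoo
  have h1 := h.adj_of_two hq.1 hq'.1 hne hq.2 hq'.2 ho.1 ho.2
  have h2 := h.adj_of_two hq.1 hq'.1 hne hq.2 hq'.2 ho'.1 ho'.2
  have hmem := h.mem_of_mem
  refine h.not_disjoint q (hmem q hq.1) x h.mem_left q' (hmem q' hq'.1) o (hmem o ho.1) y
    h.mem_mid o' (hmem o' ho'.1) ⟨hq.2, hq'.2.symm, hne, h.indep q hq.1 q' hq'.1⟩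
    ⟨h1.1, h2.1.symm, hoo, h.indep o ho.1 o' ho'.1⟩ ?_
  have e1 : o ≠ q := fun e => ho.2 (e ▸ hq.2)
  have e2 : o ≠ q' := fun e => ho.2 (e ▸ hq'.2)
  have e3 : o' ≠ q := fun e => ho'.2 (e ▸ hq.2)
  have e4 : o' ≠ q' := fun e => ho'.2 (e ▸ hq'.2)
  have := h.ne_left o ho.1
  have := h.ne_left o' ho'.1
  have := h.ne_mid q hq.1
  have := h.ne_mid q' hq'.1
  have := h.left.ne
  simp only [Finset.disjoint_insert_right, Finset.disjoint_singleton_right, Finset.mem_insert,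
    Finset.mem_singleton]
  tauto

lemma hasRayleighBound_of_three_le (h : G.CherryCover S I c x y z)
    (hI : 3 ≤ #(I.filter fun i => G.Adj i x)) : G.HasRayleighBound S #S := by
  have hcard := Finset.card_filter_add_card_filter_not (s := I) (fun i => G.Adj i x)
  have h1 := h.card_not_adj_le_one (by omega)
  set L := I.filter fun i => G.Adj i x with hL
  have hLm : ∀ l ∈ L, l ∈ I ∧ G.Adj l x := fun l hl => Finset.mem_filter.1 hl
  have hb : G.HasRayleighBound (insert x L) ((#L : ℝ) ^ 2) :=
    HasRayleighBound.of_star (Finset.card_pos.1 (by omega)) (fun l hl => (hLm l hl).2.symm)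
      fun l hl l' hl' => h.indep l (hLm l hl).1 l' (hLm l' hl').1
  refine h.hasRayleighBound_of_subset (E := {y}) (g := fun _ => y) ?_ hb (by simp) (by simp) ?_ ?_
  · exact Finset.insert_subset h.mem_left fun l hl => h.mem_of_mem l (hLm l hl).1
  · intro v hv w hw hvH hwH hne _
    simp only [Finset.mem_insert, Finset.mem_singleton, not_or] at hv hw hvH hwH
    have h1 := h.right
    have h2 := h.right.symm
    rcases hv with rfl | rfl | rfl <;> rcases hw with rfl | rfl | rfl <;> tauto
  · have h2 := Finset.card_insert_le x L
    have h3 : #(insert x L) + #I + 1 ≤ 2 * #L + 3 := by omega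
    have h4 : 2 * #L + 3 ≤ #L ^ 2 := by nlinarith
    rw [Finset.card_singleton]
    exact_mod_cast h3.trans h4

lemma hasRayleighBound_of_exists_adj_mid (h : G.CherryCover S I c x y z)
    (hx : #(I.filter fun i => G.Adj i x) ≤ 1) (hz : #(I.filter fun i => G.Adj i z) ≤ 1)
    {q : V} (hq : q ∈ I) (hqx : ¬G.Adj q x) (hqz : ¬G.Adj q z) : G.HasRayleighBound S #S := by
  set J := I.filter fun i => ¬G.Adj i x ∧ ¬G.Adj i z with hJ
  have hJm : ∀ j ∈ J, j ∈ I ∧ ¬G.Adj j x ∧ ¬G.Adj j z := fun j hj => Finset.mem_filter.1 hj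
  have hI : #I ≤ 2 + #J := by
    have hsub : I ⊆ ((I.filter fun i => G.Adj i x) ∪ I.filter fun i => G.Adj i z) ∪ J := by
      intro i hi
      simp only [hJ, Finset.mem_union, Finset.mem_filter]
      tauto
    have h1 := Finset.card_le_card hsub
    have h2 := Finset.card_union_le
      ((I.filter fun i => G.Adj i x) ∪ I.filter fun i => G.Adj i z) J
    have h3 := Finset.card_union_le (I.filter fun i => G.Adj i x) (I.filter fun i => G.Adj i z)
    omega
  have hJ1 : 1 ≤ #J := Finset.card_pos.2 ⟨q, Finset.mem_filter.2 ⟨hq, hqx, hqz⟩⟩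
  have hzJ : z ∉ J := fun hj => h.ne_right z (hJm z hj).1 rfl
  have hxJ : x ∉ insert z J := by
    rw [Finset.mem_insert, not_or]
    exact ⟨h.ne, fun hj => h.ne_left x (hJm x hj).1 rfl⟩
  set L := insert x (insert z J) with hL
  have hLc : #L = #J + 2 := by
    rw [hL, Finset.card_insert_of_notMem hxJ, Finset.card_insert_of_notMem hzJ]
  have hb : G.HasRayleighBound (insert y L) ((#L : ℝ) ^ 2) := by
    refine HasRayleighBound.of_star ⟨x, Finset.mem_insert_self _ _⟩ ?_ ?_
    · intro l hl
      simp only [hL, Finset.mem_insert] at hl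
      rcases hl with rfl | rfl | hl
      · exact h.left.symm
      · exact h.right
      · have h1 := hJm l hl
        have h2 := h.attached l h1.1
        exact (by tauto : G.Adj l y).symm
    · intro l hl l' hl'
      simp only [hL, Finset.mem_insert] at hl hl'
      have h1 := h.not_adj
      have h2 := h.symm.not_adj
      rcases hl with rfl | rfl | hl <;> rcases hl' with rfl | rfl | hl'
      · exact G.irrefl
      · exact h1
      · exact mt Adj.symm (hJm _ hl').2.1
      · exact h2
      · exact G.irrefl
      · exact mt Adj.symm (hJm _ hl').2.2
      · exact (hJm _ hl).2.1
      · exact (hJm _ hl).2.2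
      · exact h.indep l (hJm l hl).1 l' (hJm l' hl').1
  refine h.hasRayleighBound_of_superset ?_ (by simp [hL]) (by simp) (by simp [hL]) hb ?_
  · intro v hv
    simp only [hL, Finset.mem_insert] at hv
    rcases hv with rfl | rfl | rfl | hv
    exacts [h.mem_mid, h.mem_left, h.mem_right, h.mem_of_mem v (hJm v hv).1]
  · have h2 := Finset.card_insert_le y L
    have h3 : #(insert y L) + #I ≤ 2 * #L + 1 := by omega
    have h4 : 2 * #L + 1 ≤ #L ^ 2 := by nlinarith
    exact_mod_cast h3.trans h4

lemma hasRayleighBound_of_card_le_one (h : G.CherryCover S I c x y z) (hI : #I ≤ 1) :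
    G.HasRayleighBound S #S := by
  have hb : G.HasRayleighBound {y, x, z} ((#{x, z} : ℝ) ^ 2) := by
    have h1 := h.not_adj
    have h2 := h.symm.not_adj
    refine HasRayleighBound.of_star (Finset.insert_nonempty _ _) ?_ ?_
    · simp [h.left.symm, h.right]
    · simp [h1, h2]
  rw [Finset.card_pair h.ne] at hb
  refine h.hasRayleighBound_of_superset ?_ (by simp) (by simp) (by simp) hb ?_
  · simp [Finset.insert_subset_iff, h.mem_left, h.mem_mid, h.mem_right]
  · have h2 := Finset.card_le_three (a := y) (b := x) (c := z)
    have h3 : #{y, x, z} + #I ≤ 2 ^ 2 := by omega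
    exact_mod_cast h3

lemma hasRayleighBound_of_four (h : G.CherryCover S I c x y z) {q : V} (hq : q ∈ I) {b : ℝ}
    (hb : G.HasRayleighBound {x, y, z, q} b) (hcard : 4 + (#I : ℝ) ≤ b) :
    G.HasRayleighBound S #S := by
  refine h.hasRayleighBound_of_superset ?_ (by simp) (by simp) (by simp) hb ?_
  · simp [Finset.insert_subset_iff, h.mem_left, h.mem_mid, h.mem_right, h.mem_of_mem q hq]
  · have h2 : (#{x, y, z, q} : ℝ) ≤ 4 := by exact_mod_cast Finset.card_le_four
    linarith

lemma hasRayleighBound_of_five (h : G.CherryCover S I c x y z) {q q' : V} (hq : q ∈ I)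
    (hq' : q' ∈ I) {b : ℝ} (hb : G.HasRayleighBound {x, y, z, q, q'} b)
    (hcard : 5 + (#I : ℝ) ≤ b) : G.HasRayleighBound S #S := by
  refine h.hasRayleighBound_of_superset ?_ (by simp) (by simp) (by simp) hb ?_
  · simp [Finset.insert_subset_iff, h.mem_left, h.mem_mid, h.mem_right, h.mem_of_mem q hq,
      h.mem_of_mem q' hq']
  · have h2 : (#{x, y, z, q, q'} : ℝ) ≤ 5 := by exact_mod_cast Finset.card_le_five
    linarith

lemma hasRayleighBound_of_adj_ends (h : G.CherryCover S I c x y z) (hI : #I ≤ 3) {q : V}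
    (hq : q ∈ I) (hqx : G.Adj q x) (hqy : ¬G.Adj q y) (hqz : G.Adj q z) :
    G.HasRayleighBound S #S := by
  have hI' : (#I : ℝ) ≤ 3 := by exact_mod_cast hI
  refine h.hasRayleighBound_of_four hq (HasRayleighBound.of_cycle_four (a := x) (b := y) (c := z)
    (d := q) ?_ ?_ ?_ ?_ h.left hqx.symm h.right hqz.symm h.not_adj (mt Adj.symm hqy) h.ne
    (h.ne_mid q hq).symm) (by linarith) <;> simp

lemma hasRayleighBound_of_adj_left_only (h : G.CherryCover S I c x y z) (hI : #I ≤ 2) {q : V}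
    (hq : q ∈ I) (hqx : G.Adj q x) (hqy : ¬G.Adj q y) : G.HasRayleighBound S #S := by
  by_cases hqz : G.Adj q z
  · exact h.hasRayleighBound_of_adj_ends (by omega) hq hqx hqy hqz
  have hI' : (#I : ℝ) ≤ 2 := by exact_mod_cast hI
  refine h.hasRayleighBound_of_four hq (HasRayleighBound.of_path_four (a := q) (b := x) (c := y)
    (d := z) ?_ ?_ ?_ ?_ hqx h.left h.right hqy hqz h.not_adj) (by linarith) <;> simp

lemma hasRayleighBound_of_adj_all (h : G.CherryCover S I c x y z) (hI : #I ≤ 2) {q : V}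
    (hq : q ∈ I) (hqx : G.Adj q x) (hqy : G.Adj q y) (hqz : G.Adj q z) :
    G.HasRayleighBound S #S := by
  have hI' : (#I : ℝ) ≤ 2 := by exact_mod_cast hI
  refine h.hasRayleighBound_of_four hq (HasRayleighBound.of_diamond (a := y) (b := x) (c := q)
    (d := z) ?_ ?_ ?_ ?_ h.left.symm hqy.symm h.right hqx.symm hqz h.not_adj h.ne)
    (by linarith) <;> simp

lemma hasRayleighBound_of_claw_leaving_left (h : G.CherryCover S I c x y z) (hI : #I ≤ 2)
    {q q' : V} (hq : q ∈ I) (hq' : q' ∈ I) (hne : q ≠ q') (hqy : G.Adj q y) (hqy' : G.Adj q' y)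
    (hqz : ¬G.Adj q z) (hqz' : ¬G.Adj q' z) : G.HasRayleighBound S #S := by
  have hcard : #({z, q, q'} : Finset V) = 3 :=
    Finset.card_eq_three.2 ⟨z, q, q', (h.ne_right q hq).symm, (h.ne_right q' hq').symm, hne, rfl⟩
  have hb : G.HasRayleighBound {y, z, q, q'} ((#{z, q, q'} : ℝ) ^ 2) := by
    refine HasRayleighBound.of_star (Finset.insert_nonempty _ _) ?_ ?_
    · simp [h.right, hqy.symm, hqy'.symm]
    · simp [hqz, hqz', mt Adj.symm hqz, mt Adj.symm hqz', h.indep q hq q' hq',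
        h.indep q' hq' q hq]
  rw [hcard] at hb
  refine h.hasRayleighBound_of_subset (E := {x}) (g := fun _ => x) ?_ hb (by simp) (by simp) ?_ ?_
  · simp [Finset.insert_subset_iff, h.mem_mid, h.mem_right, h.mem_of_mem q hq,
      h.mem_of_mem q' hq']
  · intro v hv w hw hvH hwH hvw
    simp only [Finset.mem_insert, Finset.mem_singleton, not_or] at hv hw hvH hwH
    exact absurd (by grind) hvw
  · have h2 : (#{y, z, q, q'} : ℝ) ≤ 4 := by exact_mod_cast Finset.card_le_four
    have hI' : (#I : ℝ) ≤ 2 := by exact_mod_cast hI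
    rw [Finset.card_singleton]
    push_cast
    linarith

lemma hasRayleighBound_of_claw_mid (h : G.CherryCover S I c x y z) (hI : #I ≤ 3)
    {q q' r : V} (hq : q ∈ I) (hq' : q' ∈ I) (hr : r ∈ I) (hqq : q ≠ q') (hqr : q ≠ r)
    (hqr' : q' ≠ r) (hqy : G.Adj q y) (hqy' : G.Adj q' y) (hry : G.Adj r y) :
    G.HasRayleighBound S #S := by
  have hcard : #({q, q', r} : Finset V) = 3 :=
    Finset.card_eq_three.2 ⟨q, q', r, hqq, hqr, hqr', rfl⟩
  have hb : G.HasRayleighBound {y, q, q', r} ((#{q, q', r} : ℝ) ^ 2) := by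
    refine HasRayleighBound.of_star (Finset.insert_nonempty _ _) ?_ ?_
    · simp [hqy.symm, hqy'.symm, hry.symm]
    · have : ∀ l ∈ ({q, q', r} : Finset V), l ∈ I := by simp [hq, hq', hr]
      exact fun l hl l' hl' => h.indep l (this l hl) l' (this l' hl')
  rw [hcard] at hb
  refine h.hasRayleighBound_of_subset (E := {x, z}) (g := id) ?_ hb ?_ ?_ ?_ ?_
  · simp [Finset.insert_subset_iff, h.mem_mid, h.mem_of_mem q hq, h.mem_of_mem q' hq',
      h.mem_of_mem r hr]
  · simp [Finset.insert_subset_iff]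
  · intro v hv hvH
    simp only [Finset.mem_insert, Finset.mem_singleton, not_or, id] at hv hvH ⊢
    tauto
  · intro v _ w _ _ _ hvw hvw'
    exact absurd hvw' hvw
  · have h2 : (#{y, q, q', r} : ℝ) ≤ 4 := by exact_mod_cast Finset.card_le_four
    have hI' : (#I : ℝ) ≤ 3 := by exact_mod_cast hI
    rw [Finset.card_pair h.ne]
    push_cast
    linarith

lemma hasRayleighBound_of_butterfly (h : G.CherryCover S I c x y z) (hI : #I ≤ 2) {q q' : V}
    (hq : q ∈ I) (hq' : q' ∈ I) (hqx : G.Adj q x) (hqy : G.Adj q y) (hqz : ¬G.Adj q z)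
    (hqx' : ¬G.Adj q' x) (hqy' : G.Adj q' y) (hqz' : G.Adj q' z) : G.HasRayleighBound S #S := by
  have hI' : (#I : ℝ) ≤ 2 := by exact_mod_cast hI
  refine h.hasRayleighBound_of_five hq hq' (HasRayleighBound.of_butterfly (a := y) (b := x)
    (c := q) (d := z) (e := q') ?_ ?_ ?_ ?_ ?_ h.left.symm hqy.symm h.right hqy'.symm hqx.symm
    hqz'.symm h.not_adj (mt Adj.symm hqx') hqz (h.indep q hq q' hq')) (by linarith) <;> simp

lemma hasRayleighBound_of_card_eq_two (h : G.CherryCover S I c x y z) (hI : #I = 2)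
    (hends : ∀ i ∈ I, G.Adj i x ∨ G.Adj i z) : G.HasRayleighBound S #S := by
  obtain ⟨q, q', hne, rfl⟩ := Finset.card_eq_two.1 hI
  have hq : q ∈ ({q, q'} : Finset V) := by simp
  have hq' : q' ∈ ({q, q'} : Finset V) := by simp
  by_contra hcon
  have hmid : ∀ i ∈ ({q, q'} : Finset V), G.Adj i y ∧ ¬(G.Adj i x ∧ G.Adj i z) := by
    intro i hi
    have hiy : G.Adj i y := by
      by_contra hiy
      rcases hends i hi with hix | hiz
      · exact hcon (h.hasRayleighBound_of_adj_left_only hI.le hi hix hiy)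
      · exact hcon (h.symm.hasRayleighBound_of_adj_left_only hI.le hi hiz hiy)
    exact ⟨hiy, fun hxz => hcon (h.hasRayleighBound_of_adj_all hI.le hi hxz.1 hiy hxz.2)⟩
  obtain ⟨hqy, hqxz⟩ := hmid q hq
  obtain ⟨hqy', hqxz'⟩ := hmid q' hq'
  rcases hends q hq with hqx | hqz <;> rcases hends q' hq' with hqx' | hqz'
  · exact hcon (h.hasRayleighBound_of_claw_leaving_left hI.le hq hq' hne hqy hqy'
      (by tauto) (by tauto))
  · exact hcon (h.hasRayleighBound_of_butterfly hI.le hq hq' hqx hqy (by tauto) (by tauto)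
      hqy' hqz')
  · exact hcon (h.hasRayleighBound_of_butterfly hI.le hq' hq hqx' hqy' (by tauto) (by tauto)
      hqy hqz)
  · exact hcon (h.symm.hasRayleighBound_of_claw_leaving_left hI.le hq hq' hne hqy hqy'
      (by tauto) (by tauto))

lemma hasRayleighBound_of_lollipop (h : G.CherryCover S I c x y z) (hI : #I ≤ 3) {q r : V}
    (hq : q ∈ I) (hr : r ∈ I) (hqx : G.Adj q x) (hqy : ¬G.Adj q y)
    (hrx : ¬G.Adj r x) (hry : G.Adj r y) (hrz : G.Adj r z) : G.HasRayleighBound S #S := by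
  by_cases hqz : G.Adj q z
  · exact h.hasRayleighBound_of_adj_ends hI hq hqx hqy hqz
  have hI' : (#I : ℝ) ≤ 3 := by exact_mod_cast hI
  refine h.hasRayleighBound_of_five hq hr (HasRayleighBound.of_lollipop (a := q) (b := x)
    (c := y) (d := z) (e := r) ?_ ?_ ?_ ?_ ?_ hqx h.left h.right hry.symm hrz.symm hqy hqz
    (h.indep q hq r hr) h.not_adj (mt Adj.symm hrx)) (by linarith) <;> simp

lemma hasRayleighBound_of_two_of_three (h : G.CherryCover S I c x y z) (hI : #I = 3)
    (hx : #(I.filter fun i => G.Adj i x) = 2) : G.HasRayleighBound S #S := by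
  have hcard := Finset.card_filter_add_card_filter_not (s := I) (fun i => G.Adj i x)
  obtain ⟨q, q', hne, hqq⟩ := Finset.card_eq_two.1 hx
  obtain ⟨r, hr⟩ := Finset.card_eq_one.1 (by omega : #(I.filter fun i => ¬G.Adj i x) = 1)
  obtain ⟨hqI, hqx⟩ := Finset.mem_filter.1 (hqq ▸ Finset.mem_insert_self q {q'})
  obtain ⟨hqI', hqx'⟩ := Finset.mem_filter.1
    (hqq ▸ Finset.mem_insert_of_mem (Finset.mem_singleton_self q'))
  obtain ⟨hrI, hrx⟩ := Finset.mem_filter.1 (hr ▸ Finset.mem_singleton_self r)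
  obtain ⟨hry, hrz⟩ := h.adj_of_two hqI hqI' hne hqx hqx' hrI hrx
  by_cases hqy : G.Adj q y
  · by_cases hqy' : G.Adj q' y
    · exact h.hasRayleighBound_of_claw_mid hI.le hqI hqI' hrI hne (fun e => hrx (e ▸ hqx))
        (fun e => hrx (e ▸ hqx')) hqy hqy' hry
    · exact h.hasRayleighBound_of_lollipop hI.le hqI' hrI hqx' hqy' hrx hry hrz
  · exact h.hasRayleighBound_of_lollipop hI.le hqI hrI hqx hqy hrx hry hrz

lemma hasRayleighBound_of_two_le (h : G.CherryCover S I c x y z) (hI : 3 ≤ #I)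
    (hx : 2 ≤ #(I.filter fun i => G.Adj i x)) : G.HasRayleighBound S #S := by
  have hcard := Finset.card_filter_add_card_filter_not (s := I) (fun i => G.Adj i x)
  have h1 := h.card_not_adj_le_one hx
  rcases hx.lt_or_eq with h3 | h2
  · exact h.hasRayleighBound_of_three_le h3
  · exact h.hasRayleighBound_of_two_of_three (by omega) h2.symm

lemma hasRayleighBound (h : G.CherryCover S I c x y z) : G.HasRayleighBound S #S := by
  by_cases hI : #I ≤ 1
  · exact h.hasRayleighBound_of_card_le_one hI
  by_cases hends : ∀ i ∈ I, G.Adj i x ∨ G.Adj i z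
  · rcases (by omega : 2 ≤ #I).eq_or_lt with h2 | h3
    · exact h.hasRayleighBound_of_card_eq_two h2.symm hends
    have hle : #I ≤ #(I.filter fun i => G.Adj i x) + #(I.filter fun i => G.Adj i z) := by
      refine (Finset.card_le_card ?_).trans (Finset.card_union_le _ _)
      rw [← Finset.filter_or]
      exact fun i hi => Finset.mem_filter.2 ⟨hi, hends i hi⟩
    rcases (by omega : 2 ≤ #(I.filter fun i => G.Adj i x) ∨ 2 ≤ #(I.filter fun i => G.Adj i z))
      with hx | hz
    · exact h.hasRayleighBound_of_two_le h3 hx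
    · exact h.symm.hasRayleighBound_of_two_le h3 hz
  push Not at hends
  obtain ⟨q, hq, hqx, hqz⟩ := hends
  have hlt : ∀ v, ¬G.Adj q v → #(I.filter fun i => G.Adj i v) < #I := fun v hv =>
    Finset.card_lt_card (Finset.filter_ssubset.2 ⟨q, hq, hv⟩)
  by_cases hx : #(I.filter fun i => G.Adj i x) ≤ 1
  · by_cases hz : #(I.filter fun i => G.Adj i z) ≤ 1
    · exact h.hasRayleighBound_of_exists_adj_mid hx hz hq hqx hqz
    · exact h.symm.hasRayleighBound_of_two_le (by have := hlt z hqz; omega) (by omega)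
  · exact h.hasRayleighBound_of_two_le (by have := hlt x hqx; omega) (by omega)

end CherryCover

lemma CutConnected.hasRayleighBound {S : Finset V} (hS : G.CutConnected S) {x y z : V}
    (hx : x ∈ S) (hy : y ∈ S) (hz : z ∈ S) (h : G.IsCherry x y z) :
    G.HasRayleighBound S #S := by
  induction hk : #S using Nat.strong_induction_on generalizing S x y z with
  | _ k ih =>
  subst hk
  by_cases hirr : ∀ a ∈ S, ∀ b ∈ S, ∀ d ∈ S, ∀ a' ∈ S, ∀ b' ∈ S, ∀ d' ∈ S,
      G.IsCherry a b d → G.IsCherry a' b' d' → ¬Disjoint ({a, b, d} : Finset V) {a', b', d'}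
  · obtain ⟨I, c, hc⟩ := hS.exists_cherryCover hx hy hz h hirr
    exact hc.hasRayleighBound
  push Not at hirr
  obtain ⟨a, ha, b, hb, d, hd, a', ha', b', hb', d', hd', hc, hc', hdisj⟩ := hirr
  obtain ⟨A, B, hA, hB, hAB, rfl, hcA, hcB⟩ := hS.exists_partition {a, b, d} {a', b', d'}
    (by simp [Finset.insert_subset_iff, ha, hb, hd])
    (by simp [Finset.insert_subset_iff, ha', hb', hd']) hdisj (Finset.insert_nonempty _ _)
    hc.cutConnected hc'.cutConnected
  have haA : a ∈ A := hA (by simp)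
  have haB : a' ∈ B := hB (by simp)
  have hcard := Finset.card_union_of_disjoint hAB
  have hposA : 0 < #A := Finset.card_pos.2 ⟨a, haA⟩
  have hposB : 0 < #B := Finset.card_pos.2 ⟨a', haB⟩
  have h1 := ih #A (by omega) hcA haA (hA (by simp : b ∈ _)) (hA (by simp : d ∈ _)) hc rfl
  have h2 := ih #B (by omega) hcB haB (hB (by simp : b' ∈ _)) (hB (by simp : d' ∈ _)) hc' rfl
  rw [hcard]
  push_cast
  exact h1.union h2 hAB

lemma Connected.cutConnected (h : G.Connected) : G.CutConnected univ := by
  intro T _ hne hT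
  obtain ⟨u, hu⟩ := hne
  obtain ⟨v, hv⟩ : ∃ v, v ∉ T := by
    by_contra! hcon
    exact hT (Finset.eq_univ_iff_forall.2 hcon)
  obtain ⟨w⟩ := h.preconnected u v
  obtain ⟨e, -, h1, h2⟩ := w.exists_boundary_dart (T : Set V) hu hv
  exact ⟨e.fst, h1, e.snd, by simpa using h2, e.adj⟩

lemma Connected.exists_isCherry (h : G.Connected) (hG : G ≠ ⊤) :
    ∃ x y z, G.IsCherry x y z := by
  obtain ⟨u, v, huv, hadj⟩ : ∃ u v, u ≠ v ∧ ¬G.Adj u v := by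
    by_contra! hcon
    exact hG (eq_top_iff.2 fun u v huv => hcon u v huv)
  obtain ⟨a, ha, b, hb, hab⟩ := h.cutConnected (univ.filter fun w => w = u ∨ G.Adj u w)
    (Finset.subset_univ _) ⟨u, by simp⟩ (fun he => by
      have := Finset.mem_univ v
      rw [← he] at this
      simp [huv.symm, hadj] at this)
  simp only [Finset.mem_filter, Finset.mem_univ, true_and, Finset.mem_sdiff, not_or] at ha hb
  rcases ha with rfl | ha
  · exact absurd hab hb.2
  · exact ⟨u, a, b, ha, hab, Ne.symm hb.1, hb.2⟩

end SimpleGraph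

/-- For a connected graph `G` of order `n ≥ 3` that is not isomorphic to the complete
graph, and any real `p ≥ 4`, the negative `p`-energy of `G` is at least `n`. -/
theorem negEnergy_ge {n : ℕ} (hn : 3 ≤ n) (G : SimpleGraph (Fin n))
    (hconn : G.Connected) (hK : ¬Nonempty (G ≃g (⊤ : SimpleGraph (Fin n))))
    (p : ℝ) (hp : 4 ≤ p) :
    (n : ℝ) ≤ gNegEnergy G p := by
  obtain ⟨x, y, z, hxyz⟩ := hconn.exists_isCherry fun h => hK ⟨h ▸ SimpleGraph.Iso.refl⟩
  have h := hconn.cutConnected.hasRayleighBound (Finset.mem_univ x) (Finset.mem_univ y)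
    (Finset.mem_univ z) hxyz
  simpa using h.le_gNegEnergy hp
end

section
/- Let p ≥ 4 be a real number and let G be a connected graph of order n ≥ 4. Then E_p^+(G) ≥ (4/3)^{p/4} · n. -/
open Matrix Finset
open scoped Classical

lemma Matrix.IsHermitian.trace_pow_eq_sum_eigenvalues_pow {V : Type*} [Fintype V] [DecidableEq V]
    {A : Matrix V V ℝ} (hA : A.IsHermitian) (k : ℕ) :
    (A ^ k).trace = ∑ i, hA.eigenvalues i ^ k := by
  conv_lhs =>
    rw [hA.spectral_theorem, ← map_pow, Unitary.conjStarAlgAut_apply, trace_mul_comm, ← mul_assoc]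
  simp [diagonal_pow, trace_diagonal]

/-- If a Hermitian matrix has the same characteristic polynomial as its negation, then its
spectrum is symmetric about zero. -/
lemma Matrix.IsHermitian.sum_comp_neg_eigenvalues {V : Type*} [Fintype V] [DecidableEq V]
    {A : Matrix V V ℝ} (hA : A.IsHermitian) (h : (-A).charpoly = A.charpoly) (f : ℝ → ℝ) :
    ∑ i, f (-hA.eigenvalues i) = ∑ i, f (hA.eigenvalues i) := by
  have hneg := hA.charpoly_cfc_eq (fun x => -x)
  rw [cfc_neg_id A hA.isSelfAdjoint, h] at hneg
  have hroots := congrArg Polynomial.roots hneg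
  rw [hA.roots_charpoly_eq_eigenvalues, Polynomial.roots_prod _ _
    (Finset.prod_ne_zero_iff.2 fun _ _ => Polynomial.X_sub_C_ne_zero _)] at hroots
  have hmap := congrArg (fun s => (s.map f).sum) hroots
  simpa [Multiset.bind_singleton, Function.comp_def] using hmap.symm

namespace SimpleGraph

variable {V : Type*} [Fintype V] [DecidableEq V] (G : SimpleGraph V)

lemma charpoly_neg_adjMatrix_of_colorable_two {G : SimpleGraph V} (h : G.Colorable 2) :
    (-(G.adjMatrix ℝ)).charpoly = (G.adjMatrix ℝ).charpoly := by
  obtain ⟨c⟩ := h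
  let D : Matrix V V ℝ := diagonal fun v => if c v = 0 then 1 else -1
  have hDD : D * D = 1 := by
    rw [diagonal_mul_diagonal, ← diagonal_one]
    congr 1
    ext v
    split_ifs <;> simp
  have hconj : D * G.adjMatrix ℝ * D = -(G.adjMatrix ℝ) := by
    ext u v
    by_cases huv : G.Adj u v
    · have hne := c.valid huv
      have h2 : ∀ x y : Fin 2, x ≠ y →
          (if x = 0 then (1 : ℝ) else -1) * (if y = 0 then 1 else -1) = -1 := by
        intro x y
        fin_cases x <;> fin_cases y <;> simp
      simpa [D, mul_diagonal, diagonal_mul, huv, -adjMatrix_mul_apply, -mul_adjMatrix_apply]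
        using h2 _ _ hne
    · simp [D, mul_diagonal, diagonal_mul, huv, -adjMatrix_mul_apply, -mul_adjMatrix_apply]
  rw [← hconj, charpoly_mul_comm, ← mul_assoc, hDD, one_mul]

lemma trace_adjMatrix_sq : (G.adjMatrix ℝ ^ 2).trace = ∑ v, (G.degree v : ℝ) := by
  simp only [trace, diag_apply, pow_two, adjMatrix_mul_self_apply_self]

lemma trace_adjMatrix_pow_nonneg (k : ℕ) : 0 ≤ (G.adjMatrix ℝ ^ k).trace :=
  Finset.sum_nonneg fun v _ => by
    rw [diag_apply, adjMatrix_pow_apply_eq_card_walk]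
    positivity

lemma sum_adjMatrix_sq_apply :
    ∑ u, ∑ v, (G.adjMatrix ℝ ^ 2) u v = ∑ v, (G.degree v : ℝ) ^ 2 := by
  have hrow (u : V) : ∑ v, (G.adjMatrix ℝ ^ 2) u v =
      ∑ w, G.adjMatrix ℝ u w * G.degree w := by
    simp_rw [pow_two, mul_apply]
    rw [Finset.sum_comm]
    refine Finset.sum_congr rfl fun w _ => ?_
    rw [← Finset.mul_sum]
    simp [adjMatrix_apply, ← card_neighborFinset_eq_degree, neighborFinset_eq_filter]
  simp_rw [hrow]
  rw [Finset.sum_comm]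
  refine Finset.sum_congr rfl fun w _ => ?_
  rw [← Finset.sum_mul, pow_two]
  congr 1
  simp [adjMatrix_apply, ← card_neighborFinset_eq_degree, neighborFinset_eq_filter, G.adj_comm w]

lemma le_trace_adjMatrix_pow_four :
    2 * ∑ v, (G.degree v : ℝ) ^ 2 - ∑ v, (G.degree v : ℝ) ≤ (G.adjMatrix ℝ ^ 4).trace := by
  have hsymm (u v : V) : (G.adjMatrix ℝ ^ 2) v u = (G.adjMatrix ℝ ^ 2) u v :=
    (G.isSymm_adjMatrix.pow 2).apply u v
  have htrace : (G.adjMatrix ℝ ^ 4).trace = ∑ u, ∑ v, (G.adjMatrix ℝ ^ 2) u v ^ 2 := by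
    rw [show 4 = 2 + 2 from rfl, pow_add]
    refine Finset.sum_congr rfl fun u _ => ?_
    rw [diag_apply, mul_apply]
    exact Finset.sum_congr rfl fun v _ => by rw [hsymm, pow_two (_ : ℝ)]
  have hentry (u v : V) : (G.adjMatrix ℝ ^ 2) u v +
      (if u = v then (G.degree u : ℝ) ^ 2 - G.degree u else 0) ≤
        (G.adjMatrix ℝ ^ 2) u v ^ 2 := by
    split_ifs with huv
    · subst huv
      simp only [pow_two (G.adjMatrix ℝ), adjMatrix_mul_self_apply_self]
      linarith
    · rw [adjMatrix_pow_apply_eq_card_walk, add_zero]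
      exact_mod_cast Nat.le_self_pow two_ne_zero _
  have hsum := Finset.sum_le_sum fun u (_ : u ∈ Finset.univ) =>
    Finset.sum_le_sum fun v (_ : v ∈ Finset.univ) => hentry u v
  simp only [Finset.sum_add_distrib, sum_adjMatrix_sq_apply, Finset.sum_ite_eq,
    Finset.mem_univ, if_true, Finset.sum_sub_distrib] at hsum
  rw [htrace]
  linarith

/-- For a tree, the spectrum is symmetric, so the positive `4`-energy is half of the number of
closed walks of length four. -/
lemma IsTree.le_sum_posPart_pow_four {G : SimpleGraph V} (hG : G.IsTree)
    (hV : 3 ≤ Fintype.card V) :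
    (4 / 3 : ℝ) * Fintype.card V ≤
      ∑ i, max ((adjMatrix_isHermitian G).eigenvalues i) 0 ^ 4 := by
  set l := (adjMatrix_isHermitian G).eigenvalues
  have hsymm := (adjMatrix_isHermitian G).sum_comp_neg_eigenvalues
    (charpoly_neg_adjMatrix_of_colorable_two hG.colorable_two) fun x => max x 0 ^ 4
  have hsplit : ∑ i, l i ^ 4 = ∑ i, max (l i) 0 ^ 4 + ∑ i, max (-l i) 0 ^ 4 := by
    rw [← Finset.sum_add_distrib]
    refine Finset.sum_congr rfl fun i _ => ?_
    rcases le_total (l i) 0 with h | h <;> simp [h, Even.neg_pow (by decide : Even 4)]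
  have hfour := G.le_trace_adjMatrix_pow_four
  rw [(adjMatrix_isHermitian G).trace_pow_eq_sum_eigenvalues_pow] at hfour
  have hdeg : ∑ v, (G.degree v : ℝ) = 2 * (Fintype.card V - 1) := by
    have h1 := G.sum_degrees_eq_twice_card_edges
    have h2 := hG.card_edgeFinset
    rw [← h2]
    push_cast
    rw [add_sub_cancel_right]
    exact_mod_cast h1
  have hsq : ∑ v, (3 * (G.degree v : ℝ) - 2) ≤ ∑ v, (G.degree v : ℝ) ^ 2 := by
    refine Finset.sum_le_sum fun v _ => ?_
    rcases Nat.lt_or_ge (G.degree v) 2 with h | h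
    · interval_cases G.degree v <;> norm_num
    · have : (2 : ℝ) ≤ G.degree v := by exact_mod_cast h
      nlinarith
  rw [Finset.sum_sub_distrib, ← Finset.mul_sum, hdeg] at hsq
  simp only [Finset.sum_const, Finset.card_univ, nsmul_eq_mul] at hsq
  have hV' : (3 : ℝ) ≤ Fintype.card V := by exact_mod_cast hV
  linarith

lemma sq_add_cube_le_posPart_pow_four (x : ℝ) :
    x ^ 2 + x ^ 3 / 2 - 2 / 3 ≤ max x 0 ^ 4 := by
  rcases le_total x 0 with h | h
  · rw [max_eq_right h]
    nlinarith [mul_nonneg (neg_nonneg.2 h) (sq_nonneg (3 * x + 4)), sq_nonneg (3 * x + 4)]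
  · rw [max_eq_left h]
    nlinarith [sq_nonneg (x ^ 2 - x / 4 - 3 / 5), sq_nonneg (x - 1)]

lemma le_sum_posPart_pow_four_of_card_le_card_edgeFinset
    (hG : Fintype.card V ≤ #G.edgeFinset) :
    (4 / 3 : ℝ) * Fintype.card V ≤
      ∑ i, max ((adjMatrix_isHermitian G).eigenvalues i) 0 ^ 4 := by
  have hA := adjMatrix_isHermitian G
  have hsum := Finset.sum_le_sum fun i (_ : i ∈ Finset.univ) =>
    sq_add_cube_le_posPart_pow_four (hA.eigenvalues i)
  rw [Finset.sum_sub_distrib, Finset.sum_add_distrib, ← Finset.sum_div,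
    ← hA.trace_pow_eq_sum_eigenvalues_pow, ← hA.trace_pow_eq_sum_eigenvalues_pow,
    trace_adjMatrix_sq] at hsum
  simp only [Finset.sum_const, Finset.card_univ, nsmul_eq_mul] at hsum
  have hcube := G.trace_adjMatrix_pow_nonneg 3
  have hdeg : ∑ v, (G.degree v : ℝ) = 2 * #G.edgeFinset := by
    exact_mod_cast G.sum_degrees_eq_twice_card_edges
  have hG' : (Fintype.card V : ℝ) ≤ #G.edgeFinset := by exact_mod_cast hG
  linarith

lemma Connected.le_sum_posPart_pow_four {G : SimpleGraph V} (hG : G.Connected)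
    (hV : 3 ≤ Fintype.card V) :
    (4 / 3 : ℝ) * Fintype.card V ≤
      ∑ i, max ((adjMatrix_isHermitian G).eigenvalues i) 0 ^ 4 := by
  by_cases hT : G.IsTree
  · exact hT.le_sum_posPart_pow_four hV
  · refine G.le_sum_posPart_pow_four_of_card_le_card_edgeFinset ?_
    have hle := hG.card_vert_le_card_edgeSet_add_one
    have hne : Nat.card G.edgeSet + 1 ≠ Nat.card V :=
      fun h => hT (isTree_iff_connected_and_card.2 ⟨hG, h⟩)
    rw [Nat.card_eq_fintype_card, Nat.card_eq_fintype_card, ← edgeFinset_card] at hle hne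
    omega

/-- Power mean inequality between the positive `4`-energy and the positive `p`-energy. -/
lemma mul_rpow_le_gPosEnergy {c p : ℝ} (hc : 0 ≤ c) (hp : 4 ≤ p) (hV : 0 < Fintype.card V)
    (h : c * Fintype.card V ≤ ∑ i, max ((adjMatrix_isHermitian G).eigenvalues i) 0 ^ 4) :
    c ^ (p / 4) * Fintype.card V ≤ gPosEnergy G p := by
  set l := (adjMatrix_isHermitian G).eigenvalues with hl
  have hN : (0 : ℝ) < Fintype.card V := by exact_mod_cast hV
  have hmean := Real.rpow_arith_mean_le_arith_mean_rpow Finset.univ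
    (fun _ : V => (Fintype.card V : ℝ)⁻¹) (fun i => max (l i) 0 ^ 4) (fun _ _ => by positivity)
    (by simp [hN.ne']) (fun _ _ => by positivity) (p := p / 4) (by linarith)
  rw [← Finset.mul_sum, ← Finset.mul_sum] at hmean
  have hbase : c ≤ (Fintype.card V : ℝ)⁻¹ * ∑ i, max (l i) 0 ^ 4 := by
    rw [inv_mul_eq_div, le_div_iff₀ hN]
    exact h
  have henergy : ∑ i, (max (l i) 0 ^ 4) ^ (p / 4) = gPosEnergy G p := by
    refine Finset.sum_congr rfl fun i _ => ?_
    rw [← hl, ← Real.rpow_natCast, ← Real.rpow_mul (le_max_right _ _),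
      show ((4 : ℕ) : ℝ) * (p / 4) = p by push_cast; ring]
    split_ifs with hi
    · rw [max_eq_left hi.le]
    · rw [max_eq_right (not_lt.1 hi), Real.zero_rpow (by linarith)]
  have := (Real.rpow_le_rpow hc hbase (by linarith : 0 ≤ p / 4)).trans hmean
  rwa [henergy, inv_mul_eq_div, le_div_iff₀ hN] at this

end SimpleGraph

/-- For a connected graph `G` of order `n ≥ 4` and any real `p ≥ 4`, the positive
`p`-energy of `G` is at least `(4/3)^(p/4) * n`. -/
theorem posEnergy_ge {n : ℕ} (hn : 4 ≤ n) (G : SimpleGraph (Fin n))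
    (hconn : G.Connected) (p : ℝ) (hp : 4 ≤ p) :
    ((4 : ℝ) / 3) ^ (p / 4) * n ≤ gPosEnergy G p := by
  simpa using G.mul_rpow_le_gPosEnergy (by norm_num : (0 : ℝ) ≤ 4 / 3) hp (by simp; omega)
    (hconn.le_sum_posPart_pow_four (by simp; omega))
end

section
/- Let G be a connected graph of order n ≥ 3. Then the positive 4-energy of G satisfies E_4^+(G) ≥ (4/3) · n. -/
open Matrix Finset
open scoped Classical

section Spectral

open scoped RealInnerProductSpace

variable {V ι : Type*} [Fintype V] [DecidableEq V] [Fintype ι] {A : Matrix V V ℝ}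

lemma inner_eigenvectorBasis_toEuclideanLin (hA : A.IsHermitian) (x : EuclideanSpace ℝ V)
    (i : V) :
    ⟪hA.eigenvectorBasis i, A.toEuclideanLin x⟫ =
      hA.eigenvalues i * ⟪hA.eigenvectorBasis i, x⟫ := by
  have hT : A.toEuclideanLin (hA.eigenvectorBasis i) =
      hA.eigenvalues i • hA.eigenvectorBasis i := by
    rw [toLpLin_apply, hA.mulVec_eigenvectorBasis]
    rfl
  rw [← isSymmetric_toEuclideanLin_iff.mpr hA, hT, real_inner_smul_left]

lemma inner_toEuclideanLin_self (hA : A.IsHermitian) (x : EuclideanSpace ℝ V) :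
    ⟪x, A.toEuclideanLin x⟫ =
      ∑ i, ⟪hA.eigenvectorBasis i, x⟫ ^ 2 * hA.eigenvalues i := by
  rw [← hA.eigenvectorBasis.sum_inner_mul_inner]
  refine sum_congr rfl fun i _ => ?_
  rw [inner_eigenvectorBasis_toEuclideanLin, real_inner_comm]
  ring

lemma norm_toEuclideanLin_sq (hA : A.IsHermitian) (x : EuclideanSpace ℝ V) :
    ‖A.toEuclideanLin x‖ ^ 2 =
      ∑ i, hA.eigenvalues i ^ 2 * ⟪hA.eigenvectorBasis i, x⟫ ^ 2 := by
  rw [← hA.eigenvectorBasis.sum_sq_inner_right]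
  refine sum_congr rfl fun i _ => ?_
  rw [inner_eigenvectorBasis_toEuclideanLin, mul_pow]

/-- Peierls' inequality: the diagonal of a Hermitian matrix in any orthonormal family has smaller
`f`-trace than its spectrum, for `f` convex and nonnegative. -/
lemma sum_map_inner_le_sum_map_eigenvalues (hA : A.IsHermitian) {f : ℝ → ℝ}
    (hf : ConvexOn ℝ Set.univ f) (hf0 : ∀ t, 0 ≤ f t)
    {w : ι → EuclideanSpace ℝ V} (hw : Orthonormal ℝ w) :
    ∑ j, f ⟪w j, A.toEuclideanLin (w j)⟫ ≤ ∑ i, f (hA.eigenvalues i) := by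
  calc ∑ j, f ⟪w j, A.toEuclideanLin (w j)⟫
      ≤ ∑ j, ∑ i, ⟪hA.eigenvectorBasis i, w j⟫ ^ 2 * f (hA.eigenvalues i) := by
        refine sum_le_sum fun j _ => ?_
        rw [inner_toEuclideanLin_self hA]
        refine hf.map_sum_le (fun _ _ => sq_nonneg _) ?_ fun _ _ => Set.mem_univ _
        rw [hA.eigenvectorBasis.sum_sq_inner_right, hw.1 j, one_pow]
    _ = ∑ i, (∑ j, ⟪hA.eigenvectorBasis i, w j⟫ ^ 2) * f (hA.eigenvalues i) := by
        rw [sum_comm]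
        simp_rw [sum_mul]
    _ ≤ ∑ i, f (hA.eigenvalues i) := by
        refine sum_le_sum fun i _ => mul_le_of_le_one_left (hf0 _) ?_
        have h := hw.sum_inner_products_le (hA.eigenvectorBasis i) (s := univ)
        rw [hA.eigenvectorBasis.orthonormal.1 i, one_pow] at h
        simpa [real_inner_comm] using h

end Spectral

section PosEnergy

open scoped RealInnerProductSpace

variable {V : Type*} [Fintype V] [DecidableEq V] (G : SimpleGraph V)

lemma convexOn_max_zero_pow_four : ConvexOn ℝ Set.univ fun t : ℝ => max t 0 ^ 4 :=
  ((convexOn_id convex_univ).sup (convexOn_const 0 convex_univ)).pow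
    (fun _ _ => le_max_right _ _) 4

lemma gPosEnergy_four_eq :
    gPosEnergy G 4 = ∑ i, max ((adjMatrix_isHermitian G).eigenvalues i) 0 ^ 4 := by
  refine sum_congr rfl fun i _ => ?_
  split_ifs with h
  · rw [max_eq_left h.le]
    exact_mod_cast Real.rpow_natCast _ 4
  · rw [max_eq_right (not_lt.mp h), zero_pow four_ne_zero]

lemma gPosEnergy_four_nonneg : 0 ≤ gPosEnergy G 4 := by
  rw [gPosEnergy_four_eq]
  positivity

lemma sum_inner_pow_le_gPosEnergy_four {ι : Type*} [Fintype ι]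
    {w : ι → EuclideanSpace ℝ V} (hw : Orthonormal ℝ w) :
    ∑ j, max ⟪w j, (G.adjMatrix ℝ).toEuclideanLin (w j)⟫ 0 ^ 4 ≤ gPosEnergy G 4 := by
  rw [gPosEnergy_four_eq]
  exact sum_map_inner_le_sum_map_eigenvalues (adjMatrix_isHermitian G)
    convexOn_max_zero_pow_four (fun _ => by positivity) hw

lemma inner_toEuclideanLin_adjMatrix (x y : EuclideanSpace ℝ V) :
    ⟪x, (G.adjMatrix ℝ).toEuclideanLin y⟫ =
      ∑ u, ∑ v, x u * (G.adjMatrix ℝ u v * y v) := by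
  simp [PiLp.inner_apply, mulVec, dotProduct, mul_sum, mul_comm]

lemma eigenvalue_pow_four_le_gPosEnergy_four (i : V) :
    (adjMatrix_isHermitian G).eigenvalues i ^ 4 ≤ gPosEnergy G 4 := by
  set v := (adjMatrix_isHermitian G).eigenvectorBasis i with hv
  set a : EuclideanSpace ℝ V := WithLp.toLp 2 fun u => |v u| with ha
  have hv1 : ‖v‖ = 1 := (adjMatrix_isHermitian G).eigenvectorBasis.orthonormal.1 i
  have ha1 : ‖a‖ = 1 := by
    rw [← hv1, EuclideanSpace.norm_eq, EuclideanSpace.norm_eq]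
    simp [ha]
  have hval : ⟪v, (G.adjMatrix ℝ).toEuclideanLin v⟫ =
      (adjMatrix_isHermitian G).eigenvalues i := by
    rw [inner_eigenvectorBasis_toEuclideanLin, ← hv, real_inner_self_eq_norm_sq, hv1]
    ring
  have habs : |⟪v, (G.adjMatrix ℝ).toEuclideanLin v⟫| ≤
      ⟪a, (G.adjMatrix ℝ).toEuclideanLin a⟫ := by
    rw [inner_toEuclideanLin_adjMatrix, inner_toEuclideanLin_adjMatrix]
    refine (abs_sum_le_sum_abs _ _).trans (sum_le_sum fun u _ => ?_)
    refine (abs_sum_le_sum_abs _ _).trans (sum_le_sum fun w _ => ?_)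
    rw [abs_mul, abs_mul]
    have : |G.adjMatrix ℝ u w| = G.adjMatrix ℝ u w :=
      abs_of_nonneg (by rw [SimpleGraph.adjMatrix_apply]; split_ifs <;> norm_num)
    rw [this]
  rw [hval] at habs
  have hw : Orthonormal ℝ fun _ : Unit => a :=
    ⟨fun _ => ha1, fun i j h => absurd (Subsingleton.elim i j) h⟩
  have h := sum_inner_pow_le_gPosEnergy_four G hw
  rw [Fintype.sum_unique, max_eq_left ((abs_nonneg _).trans habs)] at h
  refine le_trans ?_ h
  rw [← Even.pow_abs (by decide : Even 4)]
  gcongr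

lemma norm_toEuclideanLin_adjMatrix_sq_le (x : EuclideanSpace ℝ V) :
    ‖(G.adjMatrix ℝ).toEuclideanLin x‖ ^ 2 ≤ √(gPosEnergy G 4) * ‖x‖ ^ 2 := by
  rw [norm_toEuclideanLin_sq (adjMatrix_isHermitian G),
    ← (adjMatrix_isHermitian G).eigenvectorBasis.sum_sq_inner_right, mul_sum]
  gcongr with i
  refine Real.le_sqrt_of_sq_le ?_
  rw [← pow_mul]
  exact eigenvalue_pow_four_le_gPosEnergy_four G i

lemma degree_sq_le_gPosEnergy_four (v : V) : (G.degree v : ℝ) ^ 2 ≤ gPosEnergy G 4 := by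
  have h := norm_toEuclideanLin_adjMatrix_sq_le G (EuclideanSpace.single v 1)
  rw [PiLp.norm_single, norm_one, one_pow, mul_one, EuclideanSpace.norm_sq_eq] at h
  have hd : ∑ u, ‖((G.adjMatrix ℝ).toEuclideanLin (EuclideanSpace.single v 1)) u‖ ^ 2 =
      G.degree v := by
    simp [← SimpleGraph.card_neighborFinset_eq_degree,
      SimpleGraph.neighborFinset_eq_filter, SimpleGraph.adj_comm]
  rw [hd] at h
  exact (pow_le_pow_left₀ (Nat.cast_nonneg _) h 2).trans_eq
    (Real.sq_sqrt (gPosEnergy_four_nonneg G))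

lemma sum_degree_sq_le_sqrt_gPosEnergy_four :
    ∑ v, (G.degree v : ℝ) ^ 2 ≤ √(gPosEnergy G 4) * Fintype.card V := by
  have h := norm_toEuclideanLin_adjMatrix_sq_le G (WithLp.toLp 2 fun _ => 1)
  rw [EuclideanSpace.norm_sq_eq, EuclideanSpace.norm_sq_eq] at h
  simpa [mulVec, dotProduct, SimpleGraph.adjMatrix_apply,
    ← SimpleGraph.card_neighborFinset_eq_degree, SimpleGraph.neighborFinset_eq_filter] using h

end PosEnergy

section Superadditive

open scoped RealInnerProductSpace

variable {V W W' : Type*}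

/-- Extension of a vector by zero along a map of index types. -/
noncomputable def extendZero (e : W → V) (a : EuclideanSpace ℝ W) : EuclideanSpace ℝ V :=
  WithLp.toLp 2 (Function.extend e a 0)

lemma extendZero_apply {e : W → V} (he : e.Injective) (a : EuclideanSpace ℝ W) (y : W) :
    extendZero e a (e y) = a y :=
  he.extend_apply _ _ y

lemma extendZero_apply_of_notMem_range {e : W → V} (a : EuclideanSpace ℝ W) {x : V}
    (hx : x ∉ Set.range e) : extendZero e a x = 0 :=
  Function.extend_apply' _ _ x hx

variable [Fintype V] [Fintype W]

lemma sum_extendZero_mul {e : W → V} (he : e.Injective) (a : EuclideanSpace ℝ W)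
    (F : V → ℝ) : ∑ x, extendZero e a x * F x = ∑ y, a y * F (e y) := by
  refine (Fintype.sum_of_injective e he _ _ (fun x hx => ?_) fun y => ?_).symm
  · rw [extendZero_apply_of_notMem_range a hx, zero_mul]
  · rw [extendZero_apply he]

lemma inner_extendZero_left {e : W → V} (he : e.Injective) (a : EuclideanSpace ℝ W)
    (b : EuclideanSpace ℝ V) : ⟪extendZero e a, b⟫ = ∑ y, a y * b (e y) := by
  rw [← sum_extendZero_mul he a fun x => b x]
  simp [PiLp.inner_apply, mul_comm]

lemma inner_extendZero_extendZero {e : W → V} (he : e.Injective) (a b : EuclideanSpace ℝ W) :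
    ⟪extendZero e a, extendZero e b⟫ = ⟪a, b⟫ := by
  rw [inner_extendZero_left he]
  simp [extendZero_apply he, PiLp.inner_apply, mul_comm]

lemma inner_extendZero_of_disjoint {e : W → V} {e' : W' → V} (he : e.Injective)
    (hdisj : ∀ i j, e i ≠ e' j) (a : EuclideanSpace ℝ W) (b : EuclideanSpace ℝ W') :
    ⟪extendZero e a, extendZero e' b⟫ = 0 := by
  rw [inner_extendZero_left he]
  refine sum_eq_zero fun y _ => ?_
  rw [extendZero_apply_of_notMem_range b fun ⟨j, hj⟩ => hdisj y j hj.symm, mul_zero]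

lemma norm_extendZero {e : W → V} (he : e.Injective) (a : EuclideanSpace ℝ W) :
    ‖extendZero e a‖ = ‖a‖ := by
  rw [norm_eq_sqrt_real_inner, norm_eq_sqrt_real_inner, inner_extendZero_extendZero he]

variable [DecidableEq V] [DecidableEq W]
variable {G : SimpleGraph V} {H : SimpleGraph W}

lemma inner_extendZero_toEuclideanLin (e : H ↪g G) (a : EuclideanSpace ℝ W) :
    ⟪extendZero e a, (G.adjMatrix ℝ).toEuclideanLin (extendZero e a)⟫ =
      ⟪a, (H.adjMatrix ℝ).toEuclideanLin a⟫ := by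
  rw [inner_toEuclideanLin_adjMatrix H, inner_toEuclideanLin_adjMatrix G]
  simp_rw [← mul_sum]
  rw [sum_extendZero_mul e.injective]
  refine sum_congr rfl fun y _ => ?_
  congr 1
  simp_rw [mul_comm _ (extendZero e a _)]
  rw [sum_extendZero_mul e.injective]
  refine sum_congr rfl fun z _ => ?_
  simp [SimpleGraph.adjMatrix_apply]

lemma inner_extendZero_eigenvectorBasis (e : H ↪g G) (i : W) :
    ⟪extendZero e ((adjMatrix_isHermitian H).eigenvectorBasis i),
      (G.adjMatrix ℝ).toEuclideanLin
        (extendZero e ((adjMatrix_isHermitian H).eigenvectorBasis i))⟫ =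
      (adjMatrix_isHermitian H).eigenvalues i := by
  rw [inner_extendZero_toEuclideanLin, inner_eigenvectorBasis_toEuclideanLin,
    real_inner_self_eq_norm_sq, OrthonormalBasis.norm_eq_one, one_pow, mul_one]

/-- The positive `4`-energy is superadditive over disjoint induced subgraphs. -/
lemma gPosEnergy_four_add_le_of_disjoint [Fintype W'] [DecidableEq W']
    {H' : SimpleGraph W'} (e : H ↪g G) (e' : H' ↪g G)
    (hdisj : ∀ i j, e i ≠ e' j) :
    gPosEnergy H 4 + gPosEnergy H' 4 ≤ gPosEnergy G 4 := by
  set u := (adjMatrix_isHermitian H).eigenvectorBasis with hu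
  set u' := (adjMatrix_isHermitian H').eigenvectorBasis with hu'
  set w : W ⊕ W' → EuclideanSpace ℝ V :=
    Sum.elim (fun i => extendZero e (u i)) fun i => extendZero e' (u' i) with hw
  have hortho : Orthonormal ℝ w := by
    refine ⟨?_, ?_⟩
    · rintro (i | i)
      · exact (norm_extendZero e.injective _).trans (u.norm_eq_one i)
      · exact (norm_extendZero e'.injective _).trans (u'.norm_eq_one i)
    · rintro (i | i) (j | j) hij
      · exact (inner_extendZero_extendZero e.injective _ _).trans
          (u.orthonormal.2 fun h => hij (congrArg _ h))
      · exact inner_extendZero_of_disjoint e.injective hdisj _ _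
      · exact inner_extendZero_of_disjoint e'.injective (fun i j => (hdisj j i).symm) _ _
      · exact (inner_extendZero_extendZero e'.injective _ _).trans
          (u'.orthonormal.2 fun h => hij (congrArg _ h))
  refine le_trans (le_of_eq ?_) (sum_inner_pow_le_gPosEnergy_four G hortho)
  simp only [Fintype.sum_sum_type, gPosEnergy_four_eq, hw, Sum.elim_inl, Sum.elim_inr, hu, hu',
    inner_extendZero_eigenvectorBasis]

end Superadditive

namespace SimpleGraph

variable {V : Type*} {G : SimpleGraph V}

lemma Connected.exists_adj_dist_lt (hG : G.Connected) {r v : V} (hv : v ≠ r) :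
    ∃ w, G.Adj v w ∧ G.dist r w < G.dist r v := by
  obtain ⟨p, hp⟩ := hG.exists_walk_length_eq_dist v r
  cases p with
  | nil => exact absurd rfl hv
  | cons h q =>
    refine ⟨_, h, ?_⟩
    rw [dist_comm, dist_comm (u := r), ← hp, Walk.length_cons]
    exact Nat.lt_succ_of_le (dist_le q)

/-- A set of vertices in which every vertex other than `b` has a neighbor of smaller rank is
connected. -/
lemma induce_connected_of_rank {s : Set V} {b : V} (hb : b ∈ s) (d : V → ℕ) (p : V → V)
    (hp : ∀ w ∈ s, w ≠ b → p w ∈ s ∧ G.Adj w (p w) ∧ d (p w) < d w) :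
    (G.induce s).Connected := by
  have hreach : ∀ k, ∀ w (hw : w ∈ s), d w = k → (G.induce s).Reachable ⟨w, hw⟩ ⟨b, hb⟩ := by
    intro k
    induction k using Nat.strong_induction_on with
    | _ k ih =>
      intro w hw hk
      by_cases hwb : w = b
      · subst hwb
        exact Reachable.refl _
      · obtain ⟨h1, h2, h3⟩ := hp w hw hwb
        have hadj : (G.induce s).Adj ⟨w, hw⟩ ⟨p w, h1⟩ := h2
        exact hadj.reachable.trans (ih _ (hk ▸ h3) _ h1 rfl)
  exact connected_iff_exists_forall_reachable _ |>.mpr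
    ⟨⟨b, hb⟩, fun w => (hreach _ w.1 w.2 rfl).symm⟩

/-- A connected graph either splits into two connected parts of order at least three, or has a
vertex adjacent to roughly half of the vertices. -/
lemma Connected.exists_partition_or_card_le [Fintype V] (hG : G.Connected)
    (hV : 3 ≤ Fintype.card V) :
    (∃ s : Set V, (G.induce s).Connected ∧ (G.induce sᶜ).Connected ∧
      3 ≤ Fintype.card s ∧ 3 ≤ Fintype.card (sᶜ : Set V)) ∨
    ∃ v, Fintype.card V ≤ 2 * G.degree v + 1 := by
  obtain ⟨r⟩ := hG.nonempty
  set d : V → ℕ := G.dist r with hd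
  have hpar : ∀ v, ∃ w, (v = r → w = r) ∧ (v ≠ r → G.Adj v w ∧ d w < d v) := by
    intro v
    by_cases hv : v = r
    · exact ⟨r, fun _ => rfl, fun h => absurd hv h⟩
    · obtain ⟨w, hw⟩ := hG.exists_adj_dist_lt hv
      exact ⟨w, fun h => absurd h hv, fun _ => hw⟩
  choose p hpr hp using hpar
  have hpr : p r = r := hpr r rfl
  set S : V → Finset V := fun u => univ.filter fun w => ∃ k, p^[k] w = u with hS
  have memS : ∀ {u w}, w ∈ S u ↔ ∃ k, p^[k] w = u := by simp [hS]
  have self_mem : ∀ u, u ∈ S u := fun u => memS.mpr ⟨0, rfl⟩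
  have mem_of_parent : ∀ {u w}, p w ∈ S u → w ∈ S u := by
    intro u w h
    obtain ⟨k, hk⟩ := memS.mp h
    exact memS.mpr ⟨k + 1, hk⟩
  have parent_mem : ∀ {u w}, w ∈ S u → w ≠ u → p w ∈ S u := by
    intro u w h hne
    obtain ⟨k, hk⟩ := memS.mp h
    cases k with
    | zero => exact absurd hk hne
    | succ k => exact memS.mpr ⟨k, hk⟩
  have root_mem : ∀ {u}, r ∈ S u → r = u := by
    intro u h
    obtain ⟨k, hk⟩ := memS.mp h
    rwa [Function.iterate_fixed hpr] at hk
  have mem_root : ∀ w, w ∈ S r := by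
    intro w
    induction hk : d w using Nat.strong_induction_on generalizing w with
    | _ k ih =>
      by_cases hw : w = r
      · exact hw ▸ self_mem r
      · exact mem_of_parent (ih _ (hk ▸ (hp w hw).2) _ rfl)
  have exists_child : ∀ {u w}, w ∈ S u → w ≠ u → ∃ c, p c = u ∧ c ≠ u ∧ w ∈ S c := by
    intro u w h hne
    obtain ⟨k, hk⟩ := memS.mp h
    induction k generalizing w with
    | zero => exact absurd hk hne
    | succ k ih =>
      by_cases hpw : p w = u
      · exact ⟨w, hpw, hne, self_mem w⟩
      · obtain ⟨c, h1, h2, h3⟩ := ih (parent_mem h hne) hpw hk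
        exact ⟨c, h1, h2, mem_of_parent h3⟩
  have hSr : S r = univ := eq_univ_iff_forall.mpr mem_root
  obtain ⟨u, hu, humax⟩ := exists_max_image (univ.filter fun u => 3 ≤ (S u).card) d
    ⟨r, by simpa [hSr] using hV⟩
  have hu3 : 3 ≤ (S u).card := (mem_filter.mp hu).2
  set C : Finset V := univ.filter fun c => p c = u ∧ c ≠ u with hC
  have hchild : ∀ c ∈ C, G.Adj u c ∧ d u < d c := by
    intro c hc
    obtain ⟨h1, h2⟩ := (mem_filter.mp hc).2
    have hcr : c ≠ r := by
      rintro rfl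
      exact h2 (hpr ▸ h1)
    have := hp c hcr
    rw [h1] at this
    exact ⟨this.1.symm, this.2⟩
  have hSC : (S u).card ≤ 1 + 2 * C.card := by
    have hsub : S u ⊆ {u} ∪ C.biUnion S := by
      intro w hw
      by_cases hwu : w = u
      · simp [hwu]
      · obtain ⟨c, h1, h2, h3⟩ := exists_child hw hwu
        exact mem_union_right _ (mem_biUnion.mpr ⟨c, by simp [hC, h1, h2], h3⟩)
    have hle : (C.biUnion S).card ≤ C.card * 2 := by
      refine card_biUnion_le_card_mul _ _ _ fun c hc => ?_
      by_contra! hlt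
      exact absurd (humax c (mem_filter.mpr ⟨mem_univ c, hlt⟩)) (not_le.mpr (hchild c hc).2)
    have := (card_le_card hsub).trans (card_union_le _ _)
    rw [card_singleton] at this
    omega
  have hCdeg : C ⊆ G.neighborFinset u := fun c hc => by
    simpa using (hchild c hc).1
  by_cases hur : u = r
  · right
    refine ⟨u, ?_⟩
    have h1 : (S u).card = Fintype.card V := by rw [hur, hSr, card_univ]
    have h2 := card_le_card hCdeg
    rw [card_neighborFinset_eq_degree] at h2
    omega
  · by_cases hcompl : 3 ≤ (S u)ᶜ.card
    · left
      refine ⟨(S u : Set V), ?_, ?_, ?_, ?_⟩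
      · refine induce_connected_of_rank (b := u) (self_mem u) d p fun w hw hwu => ?_
        refine ⟨parent_mem hw hwu, hp w ?_⟩
        rintro rfl
        exact hwu (root_mem hw)
      · refine induce_connected_of_rank (b := r) (fun h => hur (root_mem h).symm) d p
          fun w hw hwr => ?_
        exact ⟨fun h => hw (mem_of_parent h), hp w hwr⟩
      · simpa using hu3
      · rw [← Set.toFinset_card]
        simpa using hcompl
    · right
      refine ⟨u, ?_⟩
      have hpu : p u ∉ C := fun h => absurd (hchild _ h).2 (not_lt.mpr (hp u hur).2.le)
      have hins : insert (p u) C ⊆ G.neighborFinset u :=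
        insert_subset (by simpa using (hp u hur).1) hCdeg
      have h2 := card_le_card hins
      rw [card_neighborFinset_eq_degree, card_insert_of_notMem hpu] at h2
      have h3 := card_add_card_compl (S u)
      omega

lemma Connected.le_sum_degree_sq [Fintype V] (hG : G.Connected) :
    4 * Fintype.card V ≤ ∑ v, G.degree v ^ 2 + 6 := by
  have hdeg : ∀ v, 3 * G.degree v ≤ G.degree v ^ 2 + 2 := by
    intro v
    rcases Nat.lt_or_ge (G.degree v) 2 with h | h
    · interval_cases G.degree v <;> norm_num
    · nlinarith
  have hsum := sum_le_sum fun v (_ : v ∈ univ) => hdeg v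
  rw [← mul_sum, sum_degrees_eq_twice_card_edges, sum_add_distrib, sum_const, card_univ,
    smul_eq_mul] at hsum
  have hm := hG.card_vert_le_card_edgeSet_add_one
  rw [Nat.card_eq_fintype_card, Nat.card_eq_fintype_card, ← edgeFinset_card] at hm
  omega

end SimpleGraph

lemma four_thirds_mul_card_le_gPosEnergy_four_of_card_le_seven {V : Type*} [Fintype V]
    [DecidableEq V] {G : SimpleGraph V} (hG : G.Connected) (h3 : 3 ≤ Fintype.card V)
    (h7 : Fintype.card V ≤ 7) :
    (4 : ℝ) / 3 * Fintype.card V ≤ gPosEnergy G 4 := by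
  have hdeg : (4 : ℝ) * Fintype.card V ≤ ∑ v, (G.degree v : ℝ) ^ 2 + 6 := by
    exact_mod_cast hG.le_sum_degree_sq
  have hsum := sum_degree_sq_le_sqrt_gPosEnergy_four G
  have hsq := Real.sq_sqrt (gPosEnergy_four_nonneg G)
  generalize √(gPosEnergy G 4) = q at *
  rw [← hsq]
  generalize Fintype.card V = n at *
  interval_cases n <;> push_cast at * <;> nlinarith

lemma four_thirds_mul_card_le_gPosEnergy_four {V : Type*} [Fintype V] [DecidableEq V]
    {G : SimpleGraph V} (hG : G.Connected) (hV : 3 ≤ Fintype.card V) :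
    (4 : ℝ) / 3 * Fintype.card V ≤ gPosEnergy G 4 := by
  induction hn : Fintype.card V using Nat.strong_induction_on generalizing V with
  | _ n ih =>
    subst hn
    rcases hG.exists_partition_or_card_le hV with ⟨s, hs, hs', h3, h3'⟩ | ⟨v, hv⟩
    · have hcard : Fintype.card s + Fintype.card (sᶜ : Set V) = Fintype.card V := by
        rw [← Fintype.card_sum]
        exact Fintype.card_congr (Equiv.Set.sumCompl s)
      have h1 := ih _ (by omega) hs h3 rfl
      have h2 := ih _ (by omega) hs' h3' rfl
      have h4 := gPosEnergy_four_add_le_of_disjoint (SimpleGraph.Embedding.induce s)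
        (SimpleGraph.Embedding.induce sᶜ) (G := G) fun i j (hij : (i : V) = j) => j.2 (hij ▸ i.2)
      rw [← hcard]
      push_cast
      linarith
    · rcases Nat.lt_or_ge 7 (Fintype.card V) with h | h
      · have h1 := degree_sq_le_gPosEnergy_four G v
        have h2 : (Fintype.card V : ℝ) ≤ 2 * G.degree v + 1 := by exact_mod_cast hv
        have h3 : (4 : ℝ) ≤ G.degree v := by
          have : 4 ≤ G.degree v := by omega
          exact_mod_cast this
        nlinarith
      · exact four_thirds_mul_card_le_gPosEnergy_four_of_card_le_seven hG hV h

/-- For a connected graph `G` of order `n ≥ 3`, the positive `4`-energy of `G` is at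
least `4n/3`. -/
theorem posEnergy_four_ge {n : ℕ} (hn : 3 ≤ n) (G : SimpleGraph (Fin n))
    (hconn : G.Connected) :
    (4 : ℝ) / 3 * n ≤ gPosEnergy G 4 := by
  simpa using four_thirds_mul_card_le_gPosEnergy_four hconn (by simpa using hn)
end

section
/- Let G be a graph of order n ≥ 3 that is not isomorphic to the complete graph K_n and that has a dominating vertex v (a vertex adjacent to every other vertex of G). Then E_4^-(G) ≥ n + 1. -/
open Matrix Finset
open scoped Classical

lemma sub_sq_le_of_sq_le_mul {x p m d : ℝ} (hp : 0 ≤ p) (hm : 0 ≤ m) (h : d ^ 2 ≤ p * m) :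
    (x - d) ^ 2 ≤ (1 + p) * (x ^ 2 + m) := by
  have h1 : |2 * (x * d)| ≤ p * x ^ 2 + m := by
    refine abs_le_of_sq_le_sq ?_ (by positivity)
    nlinarith [mul_le_mul_of_nonneg_left h (sq_nonneg x), sq_nonneg (p * x ^ 2 - m)]
  nlinarith [neg_le_of_abs_le h1]

namespace SimpleGraph

universe u

variable {V : Type u} {G : SimpleGraph V}

/-- `G.NegFourWitness S r` says that some weighted family of vectors supported on `S`, whose frame
operator is at most the identity and whose Rayleigh quotients for the adjacency matrix are at most
`-t i ≤ 0`, has total weight `∑ w i * (t i) ^ 4 * ‖u i‖ ^ 2` at least `r`. -/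
def NegFourWitness [Fintype V] (G : SimpleGraph V) (S : Finset V) (r : ℝ) : Prop :=
  ∃ (ι : Type u) (_ : Fintype ι) (w t : ι → ℝ) (u : ι → V → ℝ),
    (∀ i, 0 ≤ w i) ∧ (∀ i, 0 ≤ t i) ∧
    (∀ i, 0 < w i → u i ⬝ᵥ G.adjMatrix ℝ *ᵥ u i ≤ -t i * (u i ⬝ᵥ u i)) ∧
    (∀ x : V → ℝ, ∑ i, w i * (u i ⬝ᵥ x) ^ 2 ≤ ∑ s ∈ S, x s ^ 2) ∧
    r ≤ ∑ i, w i * t i ^ 4 * (u i ⬝ᵥ u i)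

namespace NegFourWitness

lemma mono [Fintype V] {S : Finset V} {r r' : ℝ} (h : G.NegFourWitness S r) (hr : r' ≤ r) :
    G.NegFourWitness S r' := by
  obtain ⟨ι, _, w, t, u, h₁, h₂, h₃, h₄, h₅⟩ := h
  exact ⟨ι, _, w, t, u, h₁, h₂, h₃, h₄, hr.trans h₅⟩

lemma union [Fintype V] [DecidableEq V] {S T : Finset V} {r r' : ℝ}
    (hS : G.NegFourWitness S r) (hT : G.NegFourWitness T r') (hST : Disjoint S T) : G.NegFourWitness (S ∪ T) (r + r') := by
  obtain ⟨ι, _, w, t, u, h₁, h₂, h₃, h₄, h₅⟩ := hS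
  obtain ⟨ι', _, w', t', u', h₁', h₂', h₃', h₄', h₅'⟩ := hT
  refine ⟨ι ⊕ ι', inferInstance, Sum.elim w w', Sum.elim t t', Sum.elim u u', ?_, ?_, ?_, ?_, ?_⟩
  · rintro (i | i) <;> simp [h₁, h₁']
  · rintro (i | i) <;> simp [h₂, h₂']
  · rintro (i | i)
    · exact h₃ i
    · exact h₃' i
  · intro x
    simpa [Finset.sum_union hST] using add_le_add (h₄ x) (h₄' x)
  · simpa using add_le_add h₅ h₅'

lemma le_gNegEnergy [Fintype V] [DecidableEq V] {S : Finset V} {r : ℝ}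
    (h : G.NegFourWitness S r) : r ≤ gNegEnergy G 4 := by
  obtain ⟨ι, _, w, t, u, hw, ht, hq, hB, hr⟩ := h
  set hA := adjMatrix_isHermitian G
  set l := hA.eigenvalues with hl
  let e : V → V → ℝ := fun j => (hA.eigenvectorBasis j).ofLp
  let f : ℝ → ℝ := fun x => if x < 0 then |x| ^ (4 : ℝ) else 0
  have hf0 : ∀ x, 0 ≤ f x := fun x => by
    simp only [f]; split_ifs <;> positivity
  have hf : ∀ x s : ℝ, 0 ≤ s → -4 * s ^ 3 * x - 3 * s ^ 4 ≤ f x := by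
    intro x s hs
    simp only [f]
    split_ifs with hx
    · rw [show (4 : ℝ) = ((4 : ℕ) : ℝ) by norm_num, Real.rpow_natCast, abs_of_neg hx]
      push_cast
      nlinarith [mul_nonneg (sq_nonneg (x + s)) (add_nonneg (sq_nonneg (x - s)) (sq_nonneg s))]
    · have := mul_nonneg (pow_nonneg hs 3) (not_lt.mp hx)
      nlinarith [pow_nonneg hs 4]
  have hinner : ∀ (j : V) (x : V → ℝ),
      inner ℝ (hA.eigenvectorBasis j) (WithLp.toLp 2 x) = x ⬝ᵥ e j := by
    intro j x
    simp [e, EuclideanSpace.inner_eq_star_dotProduct]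
  have hpar : ∀ x y : V → ℝ, x ⬝ᵥ y = ∑ j, (x ⬝ᵥ e j) * (y ⬝ᵥ e j) := by
    intro x y
    have := hA.eigenvectorBasis.sum_inner_mul_inner (WithLp.toLp 2 x) (WithLp.toLp 2 y)
    rw [EuclideanSpace.inner_eq_star_dotProduct] at this
    simp only [star_trivial] at this
    rw [dotProduct_comm, ← this]
    refine Finset.sum_congr rfl fun j _ => ?_
    rw [hinner, real_inner_comm, hinner]
  have heig : ∀ (x : V → ℝ) j, (G.adjMatrix ℝ *ᵥ x) ⬝ᵥ e j = l j * (x ⬝ᵥ e j) := by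
    intro x j
    have h1 : G.adjMatrix ℝ *ᵥ e j = l j • e j := hA.mulVec_eigenvectorBasis j
    have h2 : (G.adjMatrix ℝ)ᵀ = G.adjMatrix ℝ := G.transpose_adjMatrix
    rw [dotProduct_comm, Matrix.dotProduct_mulVec, ← Matrix.mulVec_transpose, h2, h1,
      smul_dotProduct, dotProduct_comm, smul_eq_mul]
  have hnorm : ∀ j, ∑ s ∈ S, e j s ^ 2 ≤ 1 := by
    intro j
    have h1 : ‖hA.eigenvectorBasis j‖ ^ 2 = 1 := by simp
    rw [EuclideanSpace.norm_sq_eq] at h1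
    calc ∑ s ∈ S, e j s ^ 2 ≤ ∑ s, e j s ^ 2 :=
          Finset.sum_le_sum_of_subset_of_nonneg (Finset.subset_univ S) fun _ _ _ => sq_nonneg _
      _ = 1 := by rw [← h1]; simp [e]
  calc r ≤ ∑ i, w i * t i ^ 4 * (u i ⬝ᵥ u i) := hr
    _ ≤ ∑ i, w i * (-4 * t i ^ 3 * (u i ⬝ᵥ G.adjMatrix ℝ *ᵥ u i) -
          3 * t i ^ 4 * (u i ⬝ᵥ u i)) := by
        refine Finset.sum_le_sum fun i _ => ?_
        rcases (hw i).eq_or_lt with h0 | h0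
        · simp [← h0]
        · rw [mul_assoc]
          refine mul_le_mul_of_nonneg_left ?_ (hw i)
          nlinarith [mul_le_mul_of_nonneg_left (hq i h0) (pow_nonneg (ht i) 3)]
    _ = ∑ i, ∑ j, w i * (u i ⬝ᵥ e j) ^ 2 * (-4 * t i ^ 3 * l j - 3 * t i ^ 4) := by
        refine Finset.sum_congr rfl fun i _ => ?_
        rw [hpar (u i) (u i), hpar (u i) (_ *ᵥ _)]
        simp_rw [heig, Finset.mul_sum, ← Finset.sum_sub_distrib, Finset.mul_sum]
        exact Finset.sum_congr rfl fun j _ => by ring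
    _ ≤ ∑ i, ∑ j, w i * (u i ⬝ᵥ e j) ^ 2 * f (l j) :=
        Finset.sum_le_sum fun i _ => Finset.sum_le_sum fun j _ =>
          mul_le_mul_of_nonneg_left (hf _ _ (ht i)) (mul_nonneg (hw i) (sq_nonneg _))
    _ = ∑ j, (∑ i, w i * (u i ⬝ᵥ e j) ^ 2) * f (l j) := by
        rw [Finset.sum_comm]
        simp_rw [Finset.sum_mul]
    _ ≤ ∑ j, f (l j) :=
        Finset.sum_le_sum fun j _ =>
          mul_le_of_le_one_left (hf0 _) ((hB (e j)).trans (hnorm j))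

end NegFourWitness

section Frame

variable {κ : Type*} (R : Finset V) (c : V → κ)

/-- The vertices of `R` with the same colour as `i`. -/
noncomputable def colorClass (i : V) : Finset V := {j ∈ R | c j = c i}

/-- The weight attached to the vector `e_i - e_j`: the inverse of twice the size of the common
colour class of `i` and `j`, or zero if there is none. -/
noncomputable def frameWeight (p : V × V) : ℝ :=
  if p.1 ∈ R then if p.2 ∈ colorClass R c p.1 then (2 * (#(colorClass R c p.1) : ℝ))⁻¹ else 0 else 0

variable {R c}

lemma colorClass_congr {i j : V} (h : j ∈ colorClass R c i) :
    colorClass R c j = colorClass R c i := by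
  simp only [colorClass, Finset.mem_filter] at h ⊢
  rw [h.2]

lemma self_mem_colorClass {i : V} (h : i ∈ R) : i ∈ colorClass R c i := by
  simp [colorClass, h]

lemma card_colorClass_pos {i : V} (h : i ∈ R) : 0 < (#(colorClass R c i) : ℝ) := by
  exact_mod_cast Finset.card_pos.mpr ⟨i, self_mem_colorClass h⟩

lemma frameWeight_nonneg (p : V × V) : 0 ≤ frameWeight R c p := by
  unfold frameWeight
  split_ifs <;> positivity

lemma sum_frameWeight_mul [Fintype V] (F : V → V → ℝ) :
    ∑ p, frameWeight R c p * F p.1 p.2 =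
      ∑ i ∈ R, ∑ j ∈ colorClass R c i, (2 * (#(colorClass R c i) : ℝ))⁻¹ * F i j := by
  rw [Fintype.sum_prod_type]
  simp only [frameWeight, ite_mul, zero_mul]
  rw [← Finset.sum_subset (Finset.subset_univ R) (fun i _ hi => by simp [hi])]
  refine Finset.sum_congr rfl fun i hi => ?_
  simp [hi]

lemma sum_colorClass_comm (F : V → V → ℝ) :
    ∑ i ∈ R, ∑ j ∈ colorClass R c i, F i j = ∑ i ∈ R, ∑ j ∈ colorClass R c i, F j i := by
  refine Finset.sum_comm' fun i j => ?_
  simp only [colorClass, Finset.mem_filter]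
  grind

/-- Replacing `x` by its averages over colour classes does not change its pairing with a function
that is constant on colour classes. -/
lemma sum_mul_average (g x : V → ℝ) (hg : ∀ i, ∀ j ∈ colorClass R c i, g j = g i) :
    ∑ i ∈ R, g i * ((∑ j ∈ colorClass R c i, x j) / #(colorClass R c i)) = ∑ i ∈ R, g i * x i := by
  simp_rw [Finset.sum_div, Finset.mul_sum]
  rw [sum_colorClass_comm (fun i j => g i * (x j / #(colorClass R c i)))]
  refine Finset.sum_congr rfl fun i hi => ?_
  have h : ∀ j ∈ colorClass R c i, g j * (x i / #(colorClass R c j)) =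
      g i * (x i / #(colorClass R c i)) := fun j hj => by rw [hg i j hj, colorClass_congr hj]
  rw [Finset.sum_congr rfl h, Finset.sum_const, nsmul_eq_mul]
  have := card_colorClass_pos (c := c) hi
  field_simp

lemma sum_frameWeight_mul_sub_sq [Fintype V] (x : V → ℝ) :
    ∑ p, frameWeight R c p * (x p.1 - x p.2) ^ 2 =
      ∑ i ∈ R, x i ^ 2 -
        ∑ i ∈ R, ((∑ j ∈ colorClass R c i, x j) / #(colorClass R c i)) ^ 2 := by
  set m : V → ℝ := fun i => (∑ j ∈ colorClass R c i, x j) / #(colorClass R c i) with hm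
  have hmc : ∀ i, ∀ j ∈ colorClass R c i, m j = m i := fun i j hj => by
    simp only [hm, colorClass_congr hj]
  have hmm : ∑ i ∈ R, m i ^ 2 = ∑ i ∈ R, m i * x i := by
    rw [← sum_mul_average m x hmc]
    exact Finset.sum_congr rfl fun i _ => sq (m i)
  have hsq : ∑ i ∈ R, (∑ j ∈ colorClass R c i, x j ^ 2) / #(colorClass R c i) =
      ∑ i ∈ R, x i ^ 2 := by
    simpa using sum_mul_average (R := R) (c := c) (fun _ => 1) (fun i => x i ^ 2) (by simp)
  rw [sum_frameWeight_mul (fun i j => (x i - x j) ^ 2)]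
  have h : ∀ i ∈ R, ∑ j ∈ colorClass R c i,
      (2 * (#(colorClass R c i) : ℝ))⁻¹ * (x i - x j) ^ 2 =
      x i ^ 2 / 2 + (∑ j ∈ colorClass R c i, x j ^ 2) / #(colorClass R c i) / 2 - m i * x i := by
    intro i hi
    have hpos := card_colorClass_pos (c := c) hi
    rw [← Finset.mul_sum]
    simp_rw [sub_sq, Finset.sum_add_distrib, Finset.sum_sub_distrib, ← Finset.mul_sum,
      Finset.sum_const, nsmul_eq_mul, hm]
    field_simp
    ring
  rw [Finset.sum_congr rfl h, Finset.sum_sub_distrib, Finset.sum_add_distrib, ← Finset.sum_div,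
    ← Finset.sum_div, hsq, hmm]
  ring

lemma two_le_sum_inv_card_colorClass [DecidableEq V] {a b : V} (ha : a ∈ R) (hb : b ∈ R)
    (hab : c a ≠ c b) : 2 ≤ ∑ i ∈ R, (#(colorClass R c i) : ℝ)⁻¹ := by
  have hone : ∀ a ∈ R, ∑ i ∈ colorClass R c a, (#(colorClass R c i) : ℝ)⁻¹ = 1 := by
    intro a ha
    have hpos := card_colorClass_pos (c := c) ha
    rw [Finset.sum_congr rfl fun i hi => by rw [colorClass_congr hi], Finset.sum_const,
      nsmul_eq_mul, mul_inv_cancel₀ hpos.ne']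
  have hdisj : Disjoint (colorClass R c a) (colorClass R c b) := by
    rw [Finset.disjoint_left]
    intro i hi hi'
    simp only [colorClass, Finset.mem_filter] at hi hi'
    exact hab (hi.2.symm.trans hi'.2)
  calc (2 : ℝ) = ∑ i ∈ colorClass R c a ∪ colorClass R c b, (#(colorClass R c i) : ℝ)⁻¹ := by
        rw [Finset.sum_union hdisj, hone a ha, hone b hb]
        norm_num
    _ ≤ _ := Finset.sum_le_sum_of_subset_of_nonneg
        (Finset.union_subset (Finset.filter_subset _ _) (Finset.filter_subset _ _))
        fun _ _ _ => by positivity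

/-- The vector `e_i - e_j` attached to a pair `(i, j)`. -/
def diffVec [DecidableEq V] (p : V × V) : V → ℝ := Pi.single p.1 1 - Pi.single p.2 1

lemma diffVec_dotProduct [Fintype V] [DecidableEq V] (p : V × V) (x : V → ℝ) :
    diffVec p ⬝ᵥ x = x p.1 - x p.2 := by
  simp [diffVec, sub_dotProduct]

lemma diffVec_dotProduct_self [Fintype V] [DecidableEq V] (p : V × V) :
    diffVec p ⬝ᵥ diffVec p = 2 - if p.1 = p.2 then 2 else 0 := by
  by_cases h : p.1 = p.2
  · simp [diffVec, h]
  · simp [diffVec, h, Ne.symm h]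
    norm_num

lemma sum_frameWeight_mul_diffVec_sq [Fintype V] [DecidableEq V] (x : V → ℝ) :
    ∑ p, frameWeight R c p * (diffVec p ⬝ᵥ x) ^ 2 =
      ∑ i ∈ R, x i ^ 2 -
        ∑ i ∈ R, ((∑ j ∈ colorClass R c i, x j) / #(colorClass R c i)) ^ 2 := by
  simp_rw [diffVec_dotProduct]
  exact sum_frameWeight_mul_sub_sq x

lemma sum_frameWeight_mul_diffVec_self [Fintype V] [DecidableEq V] :
    ∑ p : V × V, frameWeight R c p * (diffVec p ⬝ᵥ diffVec p) =
      #R - ∑ i ∈ R, (#(colorClass R c i) : ℝ)⁻¹ := by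
  simp_rw [diffVec_dotProduct_self]
  rw [sum_frameWeight_mul (fun i j => 2 - if i = j then 2 else 0), Finset.card_eq_sum_ones,
    Nat.cast_sum, ← Finset.sum_sub_distrib]
  refine Finset.sum_congr rfl fun i hi => ?_
  have hpos := card_colorClass_pos (c := c) hi
  rw [← Finset.mul_sum, Finset.sum_sub_distrib, Finset.sum_const, Finset.sum_ite_eq,
    if_pos (self_mem_colorClass hi), nsmul_eq_mul]
  push_cast
  field_simp

lemma diffVec_dotProduct_adjMatrix_le [Fintype V] [DecidableEq V]
    (hc : ∀ i ∈ R, ∀ j ∈ R, c i = c j → i ≠ j → G.Adj i j) (p : V × V)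
    (hp : 0 < frameWeight R c p) :
    diffVec p ⬝ᵥ G.adjMatrix ℝ *ᵥ diffVec p ≤ -1 * (diffVec p ⬝ᵥ diffVec p) := by
  obtain ⟨i, j⟩ := p
  by_cases hij : i = j
  · simp [hij, diffVec]
  · have hadj : G.Adj i j := by
      unfold frameWeight at hp
      split_ifs at hp with h1 h2
      · simp only [colorClass, Finset.mem_filter] at h2
        exact hc i h1 j h2.1 h2.2.symm hij
      all_goals exact absurd hp (lt_irrefl _)
    rw [diffVec_dotProduct_self, diffVec_dotProduct]
    simp [diffVec, hij, hadj, hadj.symm]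
    norm_num

end Frame

namespace NegFourWitness

variable [Fintype V] [DecidableEq V] {R : Finset V}

lemma of_isClique (hR : G.IsClique (R : Set V)) : G.NegFourWitness R (#R - 1) := by
  let c : V → Unit := fun _ => ()
  refine ⟨V × V, inferInstance, frameWeight R c, fun _ => 1, diffVec, frameWeight_nonneg,
    fun _ => zero_le_one, diffVec_dotProduct_adjMatrix_le fun i hi j hj _ hij => hR hi hj hij,
    fun x => ?_, ?_⟩
  · rw [sum_frameWeight_mul_diffVec_sq]
    exact sub_le_self _ (Finset.sum_nonneg fun _ _ => sq_nonneg _)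
  · simp only [one_pow, mul_one, sum_frameWeight_mul_diffVec_self]
    simp only [colorClass, c, Finset.filter_true, Finset.sum_const, nsmul_eq_mul]
    gcongr
    exact mul_inv_le_one

/-- A vertex joined to a disjoint union of at least two cliques. -/
lemma of_cone {κ : Type*} {c : V → κ} {v a b : V} (hv : ∀ i ∈ R, G.Adj v i)
    (hc : ∀ i ∈ R, ∀ j ∈ R, c i = c j ↔ i = j ∨ G.Adj i j) (ha : a ∈ R) (hb : b ∈ R)
    (hab : c a ≠ c b) : G.NegFourWitness (insert v R) (#R + 2) := by
  have hvR : v ∉ R := fun h => G.irrefl (hv v h)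
  let k : V → ℝ := fun i => #(colorClass R c i)
  set q : ℝ := ∑ i ∈ R, (k i)⁻¹ with hq
  have hq2 : 2 ≤ q := two_le_sum_inv_card_colorClass ha hb hab
  obtain ⟨t, ht1, htq⟩ : ∃ t : ℝ, 1 ≤ t ∧ t ^ 2 = q :=
    ⟨√q, Real.one_le_sqrt.mpr (by linarith), Real.sq_sqrt (by linarith)⟩
  have ht0 : t ≠ 0 := by linarith
  have hk : ∀ i ∈ R, 1 ≤ k i := fun i hi => by
    have := card_colorClass_pos (c := c) hi
    exact Nat.one_le_cast.mpr (Nat.cast_pos.mp this)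
  let g : V → ℝ := fun i => (k i - 1 + t)⁻¹
  have hd : ∀ i ∈ R, 0 < k i - 1 + t := fun i hi => by linarith [hk i hi]
  have hgc : ∀ i, ∀ j ∈ colorClass R c i, g j = g i := fun i j hj => by
    simp only [g, k, colorClass_congr hj]
  let u : V → ℝ := fun i => if i = v then 1 else if i ∈ R then -g i else 0
  have huv : u v = 1 := by simp [u]
  have huR : ∀ i ∈ R, u i = -g i := fun i hi => by
    have : i ≠ v := fun h => hvR (h ▸ hi)
    simp [u, this, hi]
  have hu : ∀ x : V → ℝ, u ⬝ᵥ x = x v - ∑ i ∈ R, g i * x i := by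
    intro x
    have h0 : ∀ i ∉ insert v R, u i * x i = 0 := fun i hi => by
      rw [Finset.mem_insert, not_or] at hi
      simp [u, hi.1, hi.2]
    rw [dotProduct, ← Finset.sum_subset (Finset.subset_univ (insert v R)) fun i _ hi => h0 i hi,
      Finset.sum_insert hvR, huv, one_mul, sub_eq_add_neg, ← Finset.sum_neg_distrib]
    exact congrArg _ (Finset.sum_congr rfl fun i hi => by rw [huR i hi, neg_mul])
  set N : ℝ := 1 + ∑ i ∈ R, g i ^ 2 with hN
  have hN0 : 0 < N := add_pos_of_pos_of_nonneg one_pos (Finset.sum_nonneg fun _ _ => sq_nonneg _)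
  have huu : u ⬝ᵥ u = N := by
    rw [hu, huv, hN, sub_eq_add_neg, ← Finset.sum_neg_distrib]
    exact congrArg _ (Finset.sum_congr rfl fun i hi => by rw [huR i hi]; ring)
  have hAu : ∀ i, (G.adjMatrix ℝ *ᵥ u) i =
      (if G.Adj i v then 1 else 0) - ∑ j ∈ R, g j * if G.Adj i j then 1 else 0 := by
    intro i
    rw [Matrix.mulVec, dotProduct_comm, hu]
    simp only [SimpleGraph.adjMatrix_apply]
  have hAuv : (G.adjMatrix ℝ *ᵥ u) v = -∑ j ∈ R, g j := by
    rw [hAu, if_neg (G.irrefl), zero_sub]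
    exact congrArg _ (Finset.sum_congr rfl fun j hj => by rw [if_pos (hv j hj), mul_one])
  have hAuR : ∀ i ∈ R, (G.adjMatrix ℝ *ᵥ u) i = 1 - (k i - 1) * g i := by
    intro i hi
    rw [hAu, if_pos (hv i hi).symm]
    congr 1
    have h : ∀ j ∈ R, (g j * if G.Adj i j then 1 else 0) =
        (if c j = c i then g i else 0) - if i = j then g i else 0 := by
      intro j hj
      have hij := hc j hj i hi
      by_cases h1 : i = j
      · subst h1; simp
      · by_cases h2 : G.Adj i j
        · have h3 : c j = c i := hij.mpr (Or.inr h2.symm)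
          have h4 : g j = g i := hgc i j (by simp [colorClass, hj, h3])
          simp [h1, h2, h3, h4]
        · have h3 : c j ≠ c i := fun h => (hij.mp h).elim (fun h => h1 h.symm) fun h => h2 h.symm
          simp [h1, h2, h3]
    rw [Finset.sum_congr rfl h, Finset.sum_sub_distrib, Finset.sum_ite_eq, if_pos hi,
      ← Finset.sum_filter, Finset.sum_const, nsmul_eq_mul]
    simp only [k, colorClass]
    ring
  have hgt : t ≤ ∑ i ∈ R, g i := by
    have h1 : q / t ≤ ∑ i ∈ R, g i := by
      rw [hq, Finset.sum_div]
      refine Finset.sum_le_sum fun i hi => ?_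
      have := mul_nonneg (sub_nonneg.mpr (hk i hi)) (sub_nonneg.mpr ht1)
      rw [div_eq_mul_inv, ← mul_inv]
      exact inv_anti₀ (hd i hi) (by linarith)
    rwa [← htq, sq, mul_div_cancel_right₀ _ ht0] at h1
  have hquad : u ⬝ᵥ G.adjMatrix ℝ *ᵥ u ≤ -t * (u ⬝ᵥ u) := by
    rw [huu, hu, hAuv, hN]
    have h : ∀ i ∈ R, g i * (G.adjMatrix ℝ *ᵥ u) i = t * g i ^ 2 := by
      intro i hi
      rw [hAuR i hi]
      have := (hd i hi).ne'
      simp only [g]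
      field_simp
      ring
    rw [Finset.sum_congr rfl h, ← Finset.mul_sum]
    linarith
  let w : Option (V × V) → ℝ := fun o => o.elim N⁻¹ (frameWeight R c)
  let s : Option (V × V) → ℝ := fun o => o.elim t fun _ => 1
  let z : Option (V × V) → V → ℝ := fun o => o.elim u diffVec
  refine ⟨Option (V × V), inferInstance, w, s, z, ?_, ?_, ?_, ?_, ?_⟩
  · rintro (_ | p)
    · exact (inv_pos.mpr hN0).le
    · exact frameWeight_nonneg p
  · rintro (_ | p)
    · exact zero_le_one.trans ht1
    · exact zero_le_one
  · rintro (_ | p)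
    · exact fun _ => hquad
    · exact diffVec_dotProduct_adjMatrix_le
        (fun i hi j hj hij hne => ((hc i hi j hj).mp hij).resolve_left hne) p
  · intro x
    simp only [Fintype.sum_option, w, z, Option.elim_none, Option.elim_some,
      Finset.sum_insert hvR, sum_frameWeight_mul_diffVec_sq]
    set m : V → ℝ := fun i => (∑ j ∈ colorClass R c i, x j) / #(colorClass R c i) with hm
    have hux : u ⬝ᵥ x = x v - ∑ i ∈ R, g i * m i := by rw [hu, sum_mul_average g x hgc]
    have hcs : (∑ i ∈ R, g i * m i) ^ 2 ≤ (∑ i ∈ R, g i ^ 2) * ∑ i ∈ R, m i ^ 2 :=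
      Finset.sum_mul_sq_le_sq_mul_sq R g m
    have hmain : N⁻¹ * (u ⬝ᵥ x) ^ 2 ≤ x v ^ 2 + ∑ i ∈ R, m i ^ 2 := by
      rw [inv_mul_le_iff₀ hN0, hux, hN]
      exact sub_sq_le_of_sq_le_mul (Finset.sum_nonneg fun _ _ => sq_nonneg _)
        (Finset.sum_nonneg fun _ _ => sq_nonneg _) hcs
    linarith
  · simp only [Fintype.sum_option, w, s, z, Option.elim_none, Option.elim_some, one_pow, mul_one,
      sum_frameWeight_mul_diffVec_self, huu]
    have h4 : N⁻¹ * t ^ 4 * N = q ^ 2 := by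
      rw [← htq]
      field_simp
    rw [h4]
    change _ ≤ q ^ 2 + (#R - q)
    nlinarith

/-- The path on three vertices. -/
lemma of_path {a b c : V} (hca : G.Adj c a) (hcb : G.Adj c b) (hab : a ≠ b) (hn : ¬G.Adj a b) :
    G.NegFourWitness {c, a, b} 4 := by
  have h := of_cone (G := G) (R := {a, b}) (c := id) (v := c) (a := a) (b := b)
    (by simp [hca, hcb]) (by simp [hab, hab.symm, hn, G.adj_comm b a]) (by simp) (by simp) hab
  refine h.mono ?_
  rw [Finset.card_pair hab]
  norm_num

/-- The complete graph on four vertices with an edge removed. -/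
lemma of_diamond {v a b c : V} (hva : G.Adj v a) (hvb : G.Adj v b) (hvc : G.Adj v c)
    (hca : G.Adj c a) (hcb : G.Adj c b) (hab : a ≠ b) (hn : ¬G.Adj a b) :
    G.NegFourWitness {v, c, a, b} 6 := by
  have hn' : ¬G.Adj b a := fun h => hn h.symm
  let z : V → ℝ := Pi.single v 1 + Pi.single c 1 - Pi.single a 1 - Pi.single b 1
  have hz : ∀ x : V → ℝ, z ⬝ᵥ x = x v + x c - x a - x b := by
    intro x
    simp [z, sub_dotProduct, add_dotProduct]
  have hzz : z ⬝ᵥ z = 4 := by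
    rw [hz]
    simp [z, hva.ne, hvb.ne, hvc.ne, hca.ne, hcb.ne, hab, hva.ne', hvb.ne', hvc.ne', hca.ne',
      hcb.ne', hab.symm]
    norm_num
  have hvcvc : diffVec (v, c) ⬝ᵥ diffVec (v, c) = 2 := by
    simp [diffVec_dotProduct_self, hvc.ne]
  refine ⟨Option PUnit, inferInstance, fun o => o.elim (1 / 4) fun _ => 1 / 2,
    fun o => o.elim (3 / 2) fun _ => 1, fun o => o.elim z fun _ => diffVec (v, c),
    ?_, ?_, ?_, ?_, ?_⟩
  · rintro (_ | _) <;> norm_num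
  · rintro (_ | _) <;> norm_num
  · rintro (_ | _) _
    · have hAz : ∀ i, (G.adjMatrix ℝ *ᵥ z) i = G.adjMatrix ℝ i v + G.adjMatrix ℝ i c -
          G.adjMatrix ℝ i a - G.adjMatrix ℝ i b := fun i => by
        rw [Matrix.mulVec, dotProduct_comm, hz]
      simp only [Option.elim_none, hzz, hz, hAz]
      simp [hva, hvb, hvc, hca, hcb, hn, hn', hva.symm, hvb.symm, hvc.symm, hca.symm, hcb.symm]
      norm_num
    · simp only [Option.elim_some, hvcvc, diffVec_dotProduct]
      simp [diffVec, hvc, hvc.symm]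
      norm_num
  · intro x
    rw [Finset.sum_insert (by simp [hva.ne, hvb.ne, hvc.ne]),
      Finset.sum_insert (by simp [hca.ne, hcb.ne]), Finset.sum_pair hab]
    simp only [Fintype.sum_option, Option.elim_none, Option.elim_some, hz, diffVec_dotProduct,
      Finset.univ_unique, Finset.sum_singleton]
    nlinarith [sq_nonneg (x v + x c + x a + x b), sq_nonneg (x a - x b)]
  · simp only [Fintype.sum_option, Option.elim_none, Option.elim_some, hzz, hvcvc,
      Finset.univ_unique, Finset.sum_singleton]
    norm_num

/-- A vertex joined to a set of vertices that is not a clique. -/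
lemma of_dominating {v : V} (hv : ∀ i ∈ R, G.Adj v i) (hR : ¬G.IsClique (R : Set V)) :
    G.NegFourWitness (insert v R) (#R + 2) := by
  induction hm : #R using Nat.strong_induction_on generalizing R with
  | _ m ih =>
  subst hm
  have hvR : v ∉ R := fun h => G.irrefl (hv v h)
  by_cases hP : ∃ a ∈ R, ∃ b ∈ R, ∃ c ∈ R, G.Adj c a ∧ G.Adj c b ∧ a ≠ b ∧ ¬G.Adj a b
  · obtain ⟨a, ha, b, hb, c, hc, hca, hcb, hab, hn⟩ := hP
    have hsub : {c, a, b} ⊆ R := by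
      intro i
      simp only [Finset.mem_insert, Finset.mem_singleton]
      rintro (rfl | rfl | rfl) <;> assumption
    have hcard3 : #({c, a, b} : Finset V) = 3 :=
      Finset.card_eq_three.mpr ⟨c, a, b, hca.ne, hcb.ne, hab, rfl⟩
    set T := R \ {c, a, b} with hT
    have hTR : T ∪ {c, a, b} = R := Finset.sdiff_union_of_subset hsub
    have hdisj : Disjoint T {c, a, b} := Finset.sdiff_disjoint
    have hcard : #T + 3 = #R := by rw [← hcard3, ← Finset.card_union_of_disjoint hdisj, hTR]
    have hcard' : (#T : ℝ) + 3 = #R := by exact_mod_cast hcard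
    by_cases hTc : G.IsClique (T : Set V)
    · have h := (of_isClique hTc).union (of_diamond (hv a ha) (hv b hb) (hv c hc) hca hcb hab hn)
        (Finset.disjoint_insert_right.mpr ⟨fun h => hvR (Finset.mem_sdiff.mp h).1, hdisj⟩)
      rw [Finset.union_insert, hTR] at h
      exact h.mono (by linarith)
    · have h := (ih #T (by omega) (fun i hi => hv i (Finset.mem_sdiff.mp hi).1) hTc rfl).union
        (of_path hca hcb hab hn)
        (Finset.disjoint_insert_left.mpr ⟨fun h => hvR (hsub h), hdisj⟩)
      rw [Finset.insert_union, hTR] at h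
      exact h.mono (by linarith)
  · push Not at hP
    have htrans : ∀ a ∈ R, ∀ b ∈ R, ∀ c ∈ R, G.Adj c a → G.Adj c b → a = b ∨ G.Adj a b :=
      fun a ha b hb c hc hca hcb => or_iff_not_imp_left.mpr (hP a ha b hb c hc hca hcb)
    let κ : V → Finset V := fun i => {j ∈ R | i = j ∨ G.Adj i j}
    have hκ : ∀ i ∈ R, ∀ j ∈ R, κ i = κ j ↔ i = j ∨ G.Adj i j := by
      intro i hi j hj
      constructor
      · intro h
        have : j ∈ κ i := h ▸ (by simp [κ, hj])
        exact (Finset.mem_filter.mp this).2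
      · rintro (rfl | h)
        · rfl
        · refine Finset.filter_congr fun l hl => ?_
          constructor
          · rintro (rfl | h')
            · exact Or.inr h.symm
            · exact htrans j hj l hl i hi h h'
          · rintro (rfl | h')
            · exact Or.inr h
            · exact htrans i hi l hl j hj h.symm h'
    obtain ⟨a, ha, b, hb, hab, hn⟩ : ∃ a ∈ R, ∃ b ∈ R, a ≠ b ∧ ¬G.Adj a b := by
      by_contra! h
      exact hR fun a ha b hb hab => h a ha b hb hab
    exact of_cone hv hκ ha hb fun h => ((hκ a ha b hb).mp h).elim hab hn

end NegFourWitness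

end SimpleGraph

/-- For a graph `G` of order `n ≥ 3` that is not isomorphic to the complete graph and
has a dominating vertex `v` (adjacent to every other vertex), the negative `4`-energy
of `G` is at least `n + 1`. -/
theorem negEnergy_four_dominating {n : ℕ} (hn : 3 ≤ n) (G : SimpleGraph (Fin n))
    (hK : ¬Nonempty (G ≃g (⊤ : SimpleGraph (Fin n))))
    (v : Fin n) (hv : ∀ w, w ≠ v → G.Adj v w) :
    (n : ℝ) + 1 ≤ gNegEnergy G 4 := by
  have hR : ¬G.IsClique ((univ.erase v : Finset (Fin n)) : Set (Fin n)) := by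
    intro h
    have htop : G = ⊤ := by
      ext a b
      rw [SimpleGraph.top_adj]
      refine ⟨SimpleGraph.Adj.ne, fun hab => ?_⟩
      by_cases ha : a = v
      · exact ha ▸ hv b fun hb => hab (ha.trans hb.symm)
      · by_cases hb : b = v
        · exact hb ▸ (hv a ha).symm
        · exact h (by simp [ha]) (by simp [hb]) hab
    exact hK ⟨htop ▸ SimpleGraph.Iso.refl⟩
  have h := SimpleGraph.NegFourWitness.of_dominating
    (fun i hi => hv i (Finset.ne_of_mem_erase hi)) hR
  refine le_trans (le_of_eq ?_) h.le_gNegEnergy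
  rw [Finset.card_erase_of_mem (Finset.mem_univ v), Finset.card_univ, Fintype.card_fin,
    Nat.cast_sub (by omega)]
  push_cast
  ring
end

section
/- Let G be a connected graph of order n ≥ 3 that is not isomorphic to the complete graph K_n, and suppose there is a vertex v of G such that the graph G − v obtained by deleting v is a disjoint union of cliques (i.e., every connected component of G − v is a complete graph). Then E_4^-(G) ≥ n + 1. -/
open Matrix Finset
open scoped Classical

section Hermitian

variable {V : Type*} [Fintype V] [DecidableEq V] {A : Matrix V V ℝ}

lemma Matrix.IsHermitian.rank_add_smul_one (hA : A.IsHermitian) (t : ℝ) :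
    (A + t • (1 : Matrix V V ℝ)).rank = #{i | hA.eigenvalues i ≠ -t} := by
  have key : A + t • (1 : Matrix V V ℝ) = Unitary.conjStarAlgAut ℝ _ hA.eigenvectorUnitary
      (diagonal fun i => hA.eigenvalues i + t) := by
    have h : (diagonal fun i => hA.eigenvalues i + t) =
        diagonal (RCLike.ofReal ∘ hA.eigenvalues) + t • (1 : Matrix V V ℝ) := by
      ext i j
      by_cases hij : i = j <;> simp [diagonal, hij]
    rw [h, map_add, ← hA.spectral_theorem, map_smul, map_one]
  rw [key, Unitary.conjStarAlgAut_apply, ← Unitary.coe_star]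
  rw [rank_mul_eq_left_of_isUnit_det _ _
      ((isUnit_iff_isUnit_det _).1 (Unitary.isUnit_coe (U := star hA.eigenvectorUnitary))),
    rank_mul_eq_right_of_isUnit_det _ _
      ((isUnit_iff_isUnit_det _).1 (Unitary.isUnit_coe (U := hA.eigenvectorUnitary))),
    rank_diagonal, Fintype.card_subtype]
  simp only [ne_eq, add_eq_zero_iff_eq_neg]

lemma Matrix.IsHermitian.exists_eigenvalues_le_of_submatrix {ι : Type*} [Fintype ι] [DecidableEq ι]
    (hA : A.IsHermitian) {f : ι → V} (hf : Function.Injective f) {s : ℝ} {x : ι → ℝ}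
    (hx : x ≠ 0) (h : x ⬝ᵥ (A.submatrix f f *ᵥ x) ≤ -s * (x ⬝ᵥ x)) :
    ∃ i, hA.eigenvalues i ≤ -s := by
  by_contra! hlt
  have hB : (A + s • (1 : Matrix V V ℝ)).IsHermitian :=
    hA.add (by simp [Matrix.IsHermitian])
  have hpos : (A + s • (1 : Matrix V V ℝ)).PosDef := by
    refine hB.posDef_iff_eigenvalues_pos.2 fun i => ?_
    have hi := hB.eigenvalues_mem_spectrum_real i
    generalize hB.eigenvalues i = μ at hi ⊢
    rw [add_comm A, ← Algebra.algebraMap_eq_smul_one, ← sub_add_cancel μ s,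
      spectrum.add_mem_add_iff, hA.spectrum_real_eq_range_eigenvalues] at hi
    obtain ⟨j, hj⟩ := hi
    linarith [hlt j]
  have hlt' := (hpos.submatrix hf).dotProduct_mulVec_pos hx
  have hsub : (A + s • (1 : Matrix V V ℝ)).submatrix f f =
      A.submatrix f f + s • (1 : Matrix ι ι ℝ) := by
    ext i j
    simp [one_apply, hf.eq_iff]
  rw [hsub, add_mulVec, smul_mulVec, one_mulVec, dotProduct_add, dotProduct_smul] at hlt'
  simp only [star_trivial, smul_eq_mul] at hlt'
  linarith

end Hermitian

lemma card_add_pow_le_gNegEnergy_add_rank {V : Type*} [Fintype V] [DecidableEq V]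
    (G : SimpleGraph V) {s : ℝ} (hs : 1 < s)
    (h : ∃ i, (adjMatrix_isHermitian G).eigenvalues i ≤ -s) :
    Fintype.card V + s ^ 4 ≤
      gNegEnergy G 4 + (G.adjMatrix ℝ + (1 : ℝ) • (1 : Matrix V V ℝ)).rank := by
  obtain ⟨i₀, hi₀⟩ := h
  set l := (adjMatrix_isHermitian G).eigenvalues with hl
  have hrank := (adjMatrix_isHermitian G).rank_add_smul_one 1
  rw [← hl] at hrank
  have hcard : Fintype.card V = #{i | l i = -1} + #{i | l i ≠ -1} := by
    rw [Finset.card_filter_add_card_filter_not, Finset.card_univ]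
  have hsum : ∀ i, (if l i = -1 then (1 : ℝ) else 0) + (if i = i₀ then s ^ 4 else 0) ≤
      if l i < 0 then |l i| ^ (4 : ℝ) else 0 := by
    intro i
    by_cases hi : i = i₀
    · subst hi
      have h1 : l i ≠ -1 := by linarith
      have h2 : l i < 0 := by linarith
      have h3 : s ≤ |l i| := by rw [abs_of_neg h2]; linarith
      simp only [h1, h2, if_true, if_false, zero_add]
      rw [show (4 : ℝ) = (4 : ℕ) by norm_num, Real.rpow_natCast]
      gcongr
    · by_cases h1 : l i = -1
      · simp [hi, h1]
      · simp only [h1, hi, if_false, add_zero]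
        positivity
  have := Finset.sum_le_sum fun i (_ : i ∈ univ) => hsum i
  rw [Finset.sum_add_distrib, Finset.sum_boole, Finset.sum_ite_eq' univ i₀] at this
  simp only [mem_univ, if_true] at this
  rw [hrank, hcard, gNegEnergy, ← hl]
  push_cast
  linarith

lemma Matrix.rank_le_card_of_row_mem {m n : Type*} [Fintype m] [Fintype n] (B : Matrix m n ℝ)
    (T : Finset m) (h : ∀ i, ∃ j ∈ T, B i = B j) : B.rank ≤ #T := by
  rw [B.rank_eq_finrank_span_row]
  have : Set.range B.row ⊆ (T.image B.row : Finset (n → ℝ)) := by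
    rintro _ ⟨i, rfl⟩
    obtain ⟨j, hj, hij⟩ := h i
    exact Finset.mem_coe.2 (Finset.mem_image.2 ⟨j, hj, hij.symm⟩)
  calc _ ≤ Set.finrank ℝ ((T.image B.row : Finset (n → ℝ)) : Set (n → ℝ)) :=
        Submodule.finrank_mono (Submodule.span_mono this)
    _ ≤ #(T.image B.row) := finrank_span_finset_le_card _
    _ ≤ #T := Finset.card_image_le

namespace SimpleGraph

section

variable {V : Type*} [Fintype V] [DecidableEq V] (G : SimpleGraph V)

lemma exists_adjMatrix_eigenvalues_le {ι : Type*} [Fintype ι] [DecidableEq ι] {f : ι → V}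
    (hf : Function.Injective f) {s : ℝ} {x : ι → ℝ} (hx : x ≠ 0)
    (h : ∑ i, x i * ∑ j, (if G.Adj (f i) (f j) then 1 else 0) * x j ≤ -s * ∑ i, x i * x i) :
    ∃ i, (adjMatrix_isHermitian G).eigenvalues i ≤ -s :=
  (adjMatrix_isHermitian G).exists_eigenvalues_le_of_submatrix hf hx
    (by simpa only [dotProduct, mulVec, submatrix_apply, adjMatrix_apply] using h)

lemma exists_adjMatrix_eigenvalues_le_of_star {v : V} {S : Finset V} (hne : S.Nonempty)
    (hS : ∀ s ∈ S, G.Adj v s) (hind : ∀ s ∈ S, ∀ t ∈ S, ¬G.Adj s t) :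
    ∃ i, (adjMatrix_isHermitian G).eigenvalues i ≤ -√(#S) := by
  have hf : Function.Injective (fun o : Option S => o.elim v (fun s => (s : V))) := by
    rintro (_ | ⟨s, hs⟩) (_ | ⟨t, ht⟩) h
    · rfl
    · exact absurd h (hS t ht).ne
    · exact absurd h (hS s hs).ne'
    · simpa using h
  obtain ⟨s, hs⟩ := hne
  refine G.exists_adjMatrix_eigenvalues_le hf
    (x := fun o => o.elim (-√(#S)) (fun _ => 1)) (fun h => ?_) ?_
  · simpa using congrFun h (some ⟨s, hs⟩)
  · have h1 : ∀ s : S, G.Adj v s := fun s => hS s s.2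
    have h2 : ∀ s t : S, ¬G.Adj s t := fun s t => hind s s.2 t t.2
    have h3 := Real.mul_self_sqrt (Nat.cast_nonneg (α := ℝ) #S)
    simp [Fintype.sum_option, h1, h2, (h1 _).symm]
    nlinarith

lemma exists_adjMatrix_eigenvalues_le_of_path_three {a b c : V} (hab : G.Adj a b)
    (hbc : G.Adj b c) (hac : ¬G.Adj a c) (ac : a ≠ c) :
    ∃ i, (adjMatrix_isHermitian G).eigenvalues i ≤ -√2 := by
  have h := G.exists_adjMatrix_eigenvalues_le_of_star (v := b) (S := {a, c}) (by simp)
    (by simp [hab.symm, hbc]) (by simp [hac, G.adj_comm c])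
  simpa [card_pair ac] using h

lemma exists_adjMatrix_eigenvalues_le_of_path_four {a b c d : V} (hab : G.Adj a b)
    (hbc : G.Adj b c) (hcd : G.Adj c d) (hac : ¬G.Adj a c) (had : ¬G.Adj a d) (hbd : ¬G.Adj b d)
    (ac : a ≠ c) (ad : a ≠ d) (bd : b ≠ d) :
    ∃ i, (adjMatrix_isHermitian G).eigenvalues i ≤ -(3 / 2) := by
  have hf : Function.Injective ![a, b, c, d] := by
    intro i j
    fin_cases i <;> fin_cases j <;>
      simp [hab.ne, hbc.ne, hcd.ne, hab.ne', hbc.ne', hcd.ne', ac, ad, bd, ac.symm, ad.symm, bd.symm]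
  refine G.exists_adjMatrix_eigenvalues_le hf (x := ![2, -3, 3, -2])
    (fun h => by simpa using congrFun h 0) ?_
  simp [Fin.sum_univ_succ, hab, hbc, hcd, hac, had, hbd, hab.symm, hbc.symm, hcd.symm,
    G.adj_comm c a, G.adj_comm d a, G.adj_comm d b]
  norm_num

lemma exists_adjMatrix_eigenvalues_le_of_path_five {a b c d e : V} (hab : G.Adj a b)
    (hbc : G.Adj b c) (hcd : G.Adj c d) (hde : G.Adj d e)
    (hac : ¬G.Adj a c) (had : ¬G.Adj a d) (hae : ¬G.Adj a e) (hbd : ¬G.Adj b d)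
    (hbe : ¬G.Adj b e) (hce : ¬G.Adj c e)
    (ac : a ≠ c) (ad : a ≠ d) (ae : a ≠ e) (bd : b ≠ d) (be : b ≠ e) (ce : c ≠ e) :
    ∃ i, (adjMatrix_isHermitian G).eigenvalues i ≤ -(8 / 5) := by
  have hf : Function.Injective ![a, b, c, d, e] := by
    intro i j
    fin_cases i <;> fin_cases j <;>
      simp [hab.ne, hbc.ne, hcd.ne, hde.ne, hab.ne', hbc.ne', hcd.ne', hde.ne', ac, ad, ae, bd,
        be, ce, ac.symm, ad.symm, ae.symm, bd.symm, be.symm, ce.symm]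
  refine G.exists_adjMatrix_eigenvalues_le hf (x := ![4, -7, 8, -7, 4])
    (fun h => by simpa using congrFun h 0) ?_
  simp [Fin.sum_univ_succ, hab, hbc, hcd, hde, hac, had, hae, hbd, hbe, hce, hab.symm, hbc.symm,
    hcd.symm, hde.symm, G.adj_comm c a, G.adj_comm d a, G.adj_comm d b, G.adj_comm e a,
    G.adj_comm e b, G.adj_comm e c]
  norm_num

end

section

variable {V : Type*} {G : SimpleGraph V} {v : V}

lemma Connected.exists_adj_eq_or_adj (hconn : G.Connected)
    (htrans : ∀ a b c, a ≠ v → c ≠ v → b ≠ v → G.Adj a b → G.Adj b c → a ≠ c → G.Adj a c)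
    {u : V} (hu : u ≠ v) : ∃ t, G.Adj v t ∧ (t = u ∨ G.Adj t u) := by
  have h : Relation.ReflTransGen G.Adj v u := (G.reachable_iff_reflTransGen v u).1 (hconn v u)
  suffices u = v ∨ ∃ t, G.Adj v t ∧ (t = u ∨ G.Adj t u) from this.resolve_left hu
  clear hu
  induction h with
  | refl => exact Or.inl rfl
  | @tail b c _ hbc ih =>
    by_cases hc : c = v
    · exact Or.inl hc
    refine Or.inr ?_
    rcases ih with rfl | ⟨t, hvt, rfl | htb⟩
    · exact ⟨c, hbc, Or.inl rfl⟩
    · exact ⟨t, hvt, Or.inr hbc⟩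
    · by_cases hb : b = v
      · subst hb
        exact ⟨c, hbc, Or.inl rfl⟩
      · by_cases htc : t = c
        · exact ⟨t, hvt, Or.inl htc⟩
        · exact ⟨t, hvt, Or.inr (htrans t b c hvt.ne' hc hb htb hbc htc)⟩

variable [Fintype V] [DecidableEq V]

lemma Connected.exists_transversal (hconn : G.Connected)
    (htrans : ∀ a b c, a ≠ v → c ≠ v → b ≠ v → G.Adj a b → G.Adj b c → a ≠ c → G.Adj a c) :
    ∃ S : Finset V, (∀ s ∈ S, G.Adj v s) ∧ (∀ s ∈ S, ∀ t ∈ S, ¬G.Adj s t) ∧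
      ∀ u, u ≠ v → ∃ s ∈ S, s = u ∨ G.Adj s u := by
  obtain ⟨S, hS, hmax⟩ := Finset.exists_max_image
    ({S | (∀ s ∈ S, G.Adj v s) ∧ ∀ s ∈ S, ∀ t ∈ S, ¬G.Adj s t} : Finset (Finset V))
    Finset.card ⟨∅, by simp⟩
  rw [Finset.mem_filter_univ] at hS
  refine ⟨S, hS.1, hS.2, fun u hu => ?_⟩
  obtain ⟨t, hvt, htu⟩ := hconn.exists_adj_eq_or_adj htrans hu
  obtain ⟨s, hs, hst⟩ : ∃ s ∈ S, s = t ∨ G.Adj s t := by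
    by_contra! hno
    have htS : t ∉ S := fun h => (hno t h).1 rfl
    have := hmax (insert t S) (by
      rw [Finset.mem_filter_univ]
      refine ⟨by simpa [hvt] using hS.1, ?_⟩
      simp only [Finset.mem_insert]
      rintro a (rfl | ha) b (rfl | hb) hab
      · exact hab.ne rfl
      · exact (hno b hb).2 hab.symm
      · exact (hno a ha).2 hab
      · exact hS.2 a ha b hb hab)
    rw [Finset.card_insert_of_notMem htS] at this
    omega
  refine ⟨s, hs, ?_⟩
  by_cases hsu : s = u
  · exact Or.inl hsu
  rcases hst with rfl | hst
  · exact htu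
  rcases htu with rfl | htu
  · exact Or.inr hst
  · exact Or.inr (htrans s t u (hS.1 s hs).ne' hu hvt.ne' hst htu hsu)

lemma rank_adjMatrix_add_one_le
    (htrans : ∀ a b c, a ≠ v → c ≠ v → b ≠ v → G.Adj a b → G.Adj b c → a ≠ c → G.Adj a c)
    {S : Finset V} (hS : ∀ s ∈ S, G.Adj v s) (hdom : ∀ u, u ≠ v → ∃ s ∈ S, s = u ∨ G.Adj s u) :
    (G.adjMatrix ℝ + (1 : ℝ) • (1 : Matrix V V ℝ)).rank ≤
      1 + #S + #{s ∈ S | ∃ w, w ≠ v ∧ G.Adj s w ∧ ¬G.Adj v w} := by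
  have htwin : ∀ a b, a ≠ v → b ≠ v → (a = b ∨ G.Adj a b) → (G.Adj v a ↔ G.Adj v b) →
      (G.adjMatrix ℝ + (1 : ℝ) • (1 : Matrix V V ℝ)) a =
        (G.adjMatrix ℝ + (1 : ℝ) • (1 : Matrix V V ℝ)) b := by
    rintro a b ha hb (rfl | hab) hv
    · rfl
    funext x
    simp only [Matrix.add_apply, one_smul, adjMatrix_apply, Matrix.one_apply]
    by_cases hxa : a = x
    · subst hxa
      simp [hab.symm, hab.ne']
    by_cases hxb : b = x
    · subst hxb
      simp [hab, hab.ne]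
    have : G.Adj a x ↔ G.Adj b x := by
      by_cases hx : x = v
      · subst hx
        rw [G.adj_comm a, G.adj_comm b, hv]
      · exact ⟨fun h => htrans b a x hb hx ha hab.symm h hxb,
          fun h => htrans a b x ha hx hb hab h hxa⟩
    simp [this, hxa, hxb]
  set P : Finset V := {s ∈ S | ∃ w, w ≠ v ∧ G.Adj s w ∧ ¬G.Adj v w} with hP
  have hw : ∀ s, ∃ w, s ∈ P → w ≠ v ∧ G.Adj s w ∧ ¬G.Adj v w := fun s => by
    by_cases h : s ∈ P
    · obtain ⟨w, h⟩ := (Finset.mem_filter.1 h).2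
      exact ⟨w, fun _ => h⟩
    · exact ⟨s, fun h' => absurd h' h⟩
  choose w hw using hw
  refine (Matrix.rank_le_card_of_row_mem _ (({v} ∪ S) ∪ P.image w) fun u => ?_).trans ?_
  · by_cases hu : u = v
    · exact ⟨v, by simp, by rw [hu]⟩
    obtain ⟨s, hs, hsu⟩ := hdom u hu
    have hsv := (hS s hs).ne'
    by_cases hvu : G.Adj v u
    · exact ⟨s, by simp [hs], (htwin s u hsv hu hsu (by simp [hS s hs, hvu])).symm⟩
    · have hsu' : G.Adj s u := hsu.resolve_left (by rintro rfl; exact hvu (hS s hs))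
      have hsP : s ∈ P := Finset.mem_filter.2 ⟨hs, u, hu, hsu', hvu⟩
      obtain ⟨h1, h2, h3⟩ := hw s hsP
      refine ⟨w s, by simp only [Finset.mem_union]; exact Or.inr (Finset.mem_image_of_mem _ hsP),
        htwin u (w s) hu h1 ?_ (by simp [hvu, h3])⟩
      by_cases huw : u = w s
      · exact Or.inl huw
      · exact Or.inr (htrans u s (w s) hu h1 hsv hsu'.symm h2 huw)
  · have h1 := Finset.card_union_le ({v} ∪ S) (P.image w)
    have h2 := Finset.card_union_le {v} S
    have h3 := Finset.card_image_le (s := P) (f := w)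
    rw [Finset.card_singleton] at h2
    omega

lemma card_add_one_le_gNegEnergy_four {s : ℝ} {m : ℕ} (hs : 1 < s) (hm : (m : ℝ) + 1 ≤ s ^ 4)
    (h : ∃ i, (adjMatrix_isHermitian G).eigenvalues i ≤ -s)
    (hrank : (G.adjMatrix ℝ + (1 : ℝ) • (1 : Matrix V V ℝ)).rank ≤ m) :
    (Fintype.card V : ℝ) + 1 ≤ gNegEnergy G 4 := by
  have := card_add_pow_le_gNegEnergy_add_rank G hs h
  have : ((G.adjMatrix ℝ + (1 : ℝ) • (1 : Matrix V V ℝ)).rank : ℝ) ≤ m := mod_cast hrank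
  linarith

lemma Connected.card_add_one_le_gNegEnergy_four (hconn : G.Connected)
    (hcard : 2 ≤ Fintype.card V) (hG : G ≠ ⊤)
    (htrans : ∀ a b c, a ≠ v → c ≠ v → b ≠ v → G.Adj a b → G.Adj b c → a ≠ c → G.Adj a c) :
    (Fintype.card V : ℝ) + 1 ≤ gNegEnergy G 4 := by
  obtain ⟨S, hS, hind, hdom⟩ := hconn.exists_transversal htrans
  have hrank := rank_adjMatrix_add_one_le htrans hS hdom
  set P : Finset V := {s ∈ S | ∃ w, w ≠ v ∧ G.Adj s w ∧ ¬G.Adj v w} with hP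
  have hPS : #P ≤ #S := Finset.card_filter_le _ _
  have hne : S.Nonempty := by
    obtain ⟨u, hu⟩ := Fintype.exists_ne_of_one_lt_card hcard v
    obtain ⟨s, hs, -⟩ := hdom u hu
    exact ⟨s, hs⟩
  have hnadj : ∀ s ∈ S, ∀ t ∈ S, s ≠ t → ∀ w, w ≠ v → G.Adj s w → ¬G.Adj t w :=
    fun s hs t ht hst w hw hsw htw =>
      hind s hs t ht (htrans s w t (hS s hs).ne' (hS t ht).ne' hw hsw htw.symm hst)
  have hstar := G.exists_adjMatrix_eigenvalues_le_of_star hne hS hind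
  have hpow : √(#S : ℝ) ^ 4 = (#S : ℝ) ^ 2 := by
    rw [show 4 = 2 * 2 from rfl, pow_mul, Real.sq_sqrt (Nat.cast_nonneg _)]
  have hone : 2 ≤ #S → 1 < √(#S : ℝ) := fun h =>
    Real.lt_sqrt_of_sq_lt (by rw [one_pow]; exact_mod_cast h)
  have hcases : (#S = 1 ∧ #P = 0) ∨ (#S = 1 ∧ #P = 1) ∨ (#S = 2 ∧ #P = 0) ∨ (#S = 2 ∧ #P = 1) ∨
      (#S = 2 ∧ #P = 2) ∨ 3 ≤ #S := by
    have := hne.card_pos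
    omega
  rcases hcases with ⟨hS1, hP0⟩ | ⟨hS1, hP1⟩ | ⟨hS2, hP0⟩ | ⟨hS2, hP1⟩ | ⟨hS2, hP2⟩ | hS3
  · obtain ⟨s, rfl⟩ := Finset.card_eq_one.1 hS1
    have hsv : G.Adj v s := hS s (by simp)
    have hfull : ∀ w, w ≠ v → G.Adj v w := fun w hw => by
      by_contra hvw
      obtain ⟨t, ht, htw⟩ := hdom w hw
      obtain rfl := Finset.mem_singleton.1 ht
      have : t ∈ P := Finset.mem_filter.2
        ⟨ht, w, hw, htw.resolve_left (by rintro rfl; exact hvw hsv), hvw⟩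
      rw [Finset.card_eq_zero.1 hP0] at this
      simp at this
    refine absurd (SimpleGraph.ext ?_) hG
    funext a b
    refine propext ⟨fun h => h.ne, fun hab => ?_⟩
    change a ≠ b at hab
    by_cases ha : a = v
    · subst ha
      exact hfull b hab.symm
    by_cases hb : b = v
    · subst hb
      exact (hfull a ha).symm
    obtain ⟨t, ht, hta⟩ := hdom a ha
    obtain ⟨t', ht', htb⟩ := hdom b hb
    obtain rfl := Finset.mem_singleton.1 ht
    obtain rfl := Finset.mem_singleton.1 ht'
    rcases hta with rfl | hta
    · exact htb.resolve_left hab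
    rcases htb with rfl | htb
    · exact hta.symm
    exact htrans a t' b ha hb hsv.ne' hta.symm htb hab
  · obtain ⟨s, hs⟩ := Finset.card_eq_one.1 hP1
    have hsP : s ∈ P := by simp [hs]
    obtain ⟨hsS, w, hwv, hsw, hvw⟩ := Finset.mem_filter.1 hsP
    refine SimpleGraph.card_add_one_le_gNegEnergy_four (s := √2) (m := 3)
      (Real.lt_sqrt_of_sq_lt (by norm_num)) ?_
      (G.exists_adjMatrix_eigenvalues_le_of_path_three (hS s hsS) hsw hvw hwv.symm) (by omega)
    rw [show 4 = 2 * 2 from rfl, pow_mul, Real.sq_sqrt (by norm_num)]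
    norm_num
  · refine SimpleGraph.card_add_one_le_gNegEnergy_four (m := 3) (hone hS2.ge) ?_ hstar (by omega)
    rw [hpow, hS2]
    norm_num
  · obtain ⟨s, hs⟩ := Finset.card_eq_one.1 hP1
    have hsP : s ∈ P := by simp [hs]
    obtain ⟨hsS, w, hwv, hsw, hvw⟩ := Finset.mem_filter.1 hsP
    obtain ⟨t, htS, hts⟩ := Finset.exists_mem_ne (by omega : 1 < #S) s
    have hwt : ¬G.Adj w t := fun h => hnadj s hsS t htS hts.symm w hwv hsw h.symm
    refine SimpleGraph.card_add_one_le_gNegEnergy_four (s := 3 / 2) (m := 4) (by norm_num)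
      (by norm_num)
      (G.exists_adjMatrix_eigenvalues_le_of_path_four hsw.symm (hS s hsS).symm (hS t htS)
        (fun h => hvw h.symm) hwt (hind s hsS t htS) hwv ?_ hts.symm) (by omega)
    rintro rfl
    exact hvw (hS _ htS)
  · obtain ⟨s, t, hst, hPst⟩ := Finset.card_eq_two.1 hP2
    have hsP : s ∈ P := by simp [hPst]
    have htP : t ∈ P := by simp [hPst]
    obtain ⟨hsS, w, hwv, hsw, hvw⟩ := Finset.mem_filter.1 hsP
    obtain ⟨htS, x, hxv, htx, hvx⟩ := Finset.mem_filter.1 htP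
    have hwt : ¬G.Adj w t := fun h => hnadj s hsS t htS hst w hwv hsw h.symm
    have hsx : ¬G.Adj s x := hnadj t htS s hsS hst.symm x hxv htx
    have hwx : w ≠ x := by
      rintro rfl
      exact hsx hsw
    refine SimpleGraph.card_add_one_le_gNegEnergy_four (s := 8 / 5) (m := 5) (by norm_num)
      (by norm_num)
      (G.exists_adjMatrix_eigenvalues_le_of_path_five hsw.symm (hS s hsS).symm (hS t htS) htx
        (fun h => hvw h.symm) hwt (fun h => ?_) (hind s hsS t htS) hsx hvx hwv ?_ hwx hst ?_
        hxv.symm) (by omega)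
    · exact hsx (htrans s w x (hS s hsS).ne' hxv hwv hsw h (by rintro rfl; exact hvx (hS _ hsS)))
    · rintro rfl
      exact hvw (hS _ htS)
    · rintro rfl
      exact hvx (hS _ hsS)
  · refine SimpleGraph.card_add_one_le_gNegEnergy_four (m := 1 + 2 * #S) (hone (by omega)) ?_ hstar
      (by omega)
    rw [hpow]
    have : (3 : ℝ) ≤ #S := mod_cast hS3
    push_cast
    nlinarith

end

end SimpleGraph

/-- For a connected graph `G` of order `n ≥ 3` that is not isomorphic to the complete
graph, if there is a vertex `v` such that `G - v` is a disjoint union of cliques (every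
connected component of `G - v` is complete, i.e. any two distinct vertices in the same
component of `G - v` are adjacent), then the negative `4`-energy of `G` is at least
`n + 1`. -/
theorem negEnergy_four_of_deleteVertex_unionOfCliques {n : ℕ} (hn : 3 ≤ n)
    (G : SimpleGraph (Fin n)) (hconn : G.Connected)
    (hK : ¬Nonempty (G ≃g (⊤ : SimpleGraph (Fin n))))
    (v : Fin n)
    (hcliques : ∀ a b : ({v}ᶜ : Set (Fin n)),
      (G.induce ({v}ᶜ : Set (Fin n))).Reachable a b → a ≠ b →
        (G.induce ({v}ᶜ : Set (Fin n))).Adj a b) :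
    (n : ℝ) + 1 ≤ gNegEnergy G 4 := by
  have htop : G ≠ ⊤ := by
    rintro rfl
    exact hK ⟨SimpleGraph.Iso.refl⟩
  have htrans : ∀ a b c, a ≠ v → c ≠ v → b ≠ v → G.Adj a b → G.Adj b c → a ≠ c → G.Adj a c := by
    intro a b c ha hc hb hab hbc hac
    have h1 : (G.induce ({v}ᶜ : Set (Fin n))).Adj ⟨a, ha⟩ ⟨b, hb⟩ := hab
    have h2 : (G.induce ({v}ᶜ : Set (Fin n))).Adj ⟨b, hb⟩ ⟨c, hc⟩ := hbc
    exact hcliques ⟨a, ha⟩ ⟨c, hc⟩ (h1.reachable.trans h2.reachable)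
      fun h => hac (congrArg Subtype.val h)
  simpa using hconn.card_add_one_le_gNegEnergy_four (by simp; omega) htop htrans
end
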